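/- arXiv:1908.03294 — 4 statements merged into one kernel-verified Lean document; each statement's English description precedes it below -/
import Mathlib

section
/- Suppose (q,k₀) ∈ {(2,3),(3,2)}, k ≥ k₀, q·d − (q−1)·n ≥ 1 and q·r_{q,n,k,d} ≥ k, where r_{q,n,k,d} = q^{k−1}·n − [k]_q·d. Then there is a bijection between the set of equivalence classes of LCD [n,k,d] codes over 𝔽_q with dual distance d⊥ ≥ 2 and the set of equivalence classes of LCD [q·r_{q,n,k,d}, k, (q−1)·r_{q,n,k,d}] codes over 𝔽_q with dual distance d⊥ ≥ 2. -/
open Matrix Finset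

/-- The (Hamming) weight of a vector. -/
def wt {R : Type*} [Zero R] [DecidableEq R] {n : ℕ} (x : Fin n → R) : ℕ :=
  (Finset.univ.filter fun i => x i ≠ 0).card

/-- The dual code of a linear code, w.r.t. the standard inner product. -/
def dualCode {R : Type*} [CommRing R] {n : ℕ} (C : Submodule R (Fin n → R)) :
    Submodule R (Fin n → R) where
  carrier := {x | ∀ y ∈ C, ∑ i, x i * y i = 0}
  add_mem' := by
    intro a b ha hb y hy
    have ha' := ha y hy
    have hb' := hb y hy
    simp only [Set.mem_setOf_eq, Pi.add_apply, add_mul, Finset.sum_add_distrib, ha', hb',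
      add_zero]
  zero_mem' := by intro y hy; simp
  smul_mem' := by
    intro c x hx y hy
    have h := hx y hy
    simp only [Set.mem_setOf_eq, Pi.smul_apply, smul_eq_mul, mul_assoc, ← Finset.mul_sum, h,
      mul_zero]

/-- A linear code is LCD if it intersects its dual trivially. -/
def IsLCD {R : Type*} [CommRing R] {n : ℕ} (C : Submodule R (Fin n → R)) : Prop :=
  C ⊓ dualCode C = ⊥

/-- `C` has minimum weight `d`. -/
def HasMinWeight {R : Type*} [CommRing R] [DecidableEq R] {n : ℕ}
    (C : Submodule R (Fin n → R)) (d : ℕ) : Prop :=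
  (∃ x ∈ C, x ≠ 0 ∧ wt x = d) ∧ ∀ x ∈ C, x ≠ 0 → d ≤ wt x

/-- The dual distance of `C` is at least `d`. -/
def DualDistGe {R : Type*} [CommRing R] [DecidableEq R] {n : ℕ}
    (C : Submodule R (Fin n → R)) (d : ℕ) : Prop :=
  ∀ x ∈ dualCode C, x ≠ 0 → d ≤ wt x

/-- A monomial matrix: exactly one nonzero entry in each row and column. -/
def IsMonomial {R : Type*} [CommRing R] {n : ℕ} (P : Matrix (Fin n) (Fin n) R) : Prop :=
  ∃ (σ : Equiv.Perm (Fin n)) (c : Fin n → R), (∀ i, c i ≠ 0) ∧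
    ∀ i j, P i j = if σ i = j then c i else 0

/-- Two codes of the same length are equivalent if one is the image of the other
under (right) multiplication by a monomial matrix. -/
def codeEquiv {R : Type*} [CommRing R] {n : ℕ} (C₁ C₂ : Submodule R (Fin n → R)) : Prop :=
  ∃ P : Matrix (Fin n) (Fin n) R, IsMonomial P ∧ C₂ = C₁.map (Matrix.vecMulLinear P)

/-- `G` is a generator matrix of `C`: the rows of `G` form a basis of `C`. -/
def IsGenMatrix {R : Type*} [CommRing R] {k n : ℕ} (C : Submodule R (Fin n → R))
    (G : Matrix (Fin k) (Fin n) R) : Prop :=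
  LinearIndependent R (fun i : Fin k => G i) ∧
    Submodule.span R (Set.range fun i : Fin k => G i) = C

/-- The code generated by the rows of a matrix. -/
def rowSpace {R : Type*} [CommRing R] {k n : ℕ} (G : Matrix (Fin k) (Fin n) R) :
    Submodule R (Fin n → R) :=
  Submodule.span R (Set.range fun i : Fin k => G i)

/-- `[k]_q = (q^k - 1)/(q - 1) = 1 + q + ⋯ + q^(k-1)`. -/
def qrep (q k : ℕ) : ℕ := ∑ i ∈ Finset.range k, q ^ i

/-- The columns of the simplex-code generator matrix `S_{q,k}`, defined inductively. -/
def simplexCol (q : ℕ) : (k : ℕ) → ℕ → (Fin k → ZMod q)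
  | 0, _ => fun i => i.elim0
  | (k+1), j =>
    if j < qrep q k then Fin.snoc (simplexCol q k j) 0
    else if j = qrep q k then Fin.snoc (fun _ => 0) 1
    else Fin.snoc (simplexCol q k ((j - qrep q k - 1) % qrep q k))
      (((j - qrep q k - 1) / qrep q k + 1 : ℕ) : ZMod q)

/-- The generator matrix `S_{q,k}` of the simplex code. -/
def simplexMatrix (q k : ℕ) : Matrix (Fin k) (Fin (qrep q k)) (ZMod q) :=
  Matrix.of fun i j => simplexCol q k (j : ℕ) i

/-- Juxtaposition `(A | B)` of two matrices. -/
def hcat {R : Type*} {k a b : ℕ} (A : Matrix (Fin k) (Fin a) R) (B : Matrix (Fin k) (Fin b) R) :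
    Matrix (Fin k) (Fin (a + b)) R :=
  Matrix.of fun i j =>
    if h : (j : ℕ) < a then A i ⟨j, h⟩ else B i ⟨(j : ℕ) - a, by have := j.isLt; omega⟩

/-- `A^{(s)}`: juxtaposition of `s` copies of `A`. -/
def reps {R : Type*} {k r : ℕ} (A : Matrix (Fin k) (Fin r) R) (s : ℕ) :
    Matrix (Fin k) (Fin (r * s)) R :=
  Matrix.of fun i j => A i ⟨(j : ℕ) % r,
    Nat.mod_lt _ (Nat.pos_of_ne_zero fun hr => by subst hr; simpa using j.isLt)⟩

/-- The list of columns of `G_{q,k}(m)`: `m i` copies of the `i`-th column of `S_{q,k}`. -/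
def colList (q k : ℕ) (m : Fin (qrep q k) → ℕ) : List (Fin k → ZMod q) :=
  (List.finRange (qrep q k)).flatMap fun i => List.replicate (m i) (simplexCol q k (i : ℕ))

lemma colList_length (q k : ℕ) (m : Fin (qrep q k) → ℕ) :
    (colList q k m).length = ∑ i, m i := by
  simp [colList, List.length_flatMap, Function.comp_def]
  rw [← List.ofFn_eq_map, List.sum_ofFn]

/-- The matrix `G_{q,k}(m)`, consisting of `m i` copies of the `i`-th column of `S_{q,k}`. -/
def Gqk (q k : ℕ) (m : Fin (qrep q k) → ℕ) : Matrix (Fin k) (Fin (∑ i, m i)) (ZMod q) :=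
  Matrix.of fun i j => (colList q k m).get (Fin.cast (colList_length q k m).symm j) i

section Counting

open Module
open scoped LinearAlgebra.Projectivization

variable {F : Type*} [Field F] [Fintype F] [DecidableEq F]
variable {V : Type*} [AddCommGroup V] [Module F V] [Fintype V]

lemma card_mul_sum_eq_zero (φ : V →ₗ[F] F) (hφ : φ ≠ 0) :
    (Fintype.card F : ℤ) * ∑ x, (if φ x = 0 then 1 else 0 : ℤ) = Fintype.card V := by
  classical
  have h := (LinearMap.ker φ).card_eq_card_quotient_mul_card
  rw [Nat.card_congr (φ.quotKerEquivOfSurjective (LinearMap.surjective hφ)).toEquiv,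
    Nat.card_eq_fintype_card, Nat.card_eq_fintype_card, Nat.card_eq_fintype_card] at h
  rw [Finset.sum_boole, h, mul_comm, Fintype.card_subtype]
  push_cast
  simp [LinearMap.mem_ker]

lemma card_mul_sum_ne_zero (φ : V →ₗ[F] F) (hφ : φ ≠ 0) :
    (Fintype.card F : ℤ) * ∑ x, (if φ x ≠ 0 then 1 else 0 : ℤ) =
      (Fintype.card F - 1) * Fintype.card V := by
  have h := card_mul_sum_eq_zero φ hφ
  have h2 : ∑ x, (if φ x ≠ 0 then 1 else 0 : ℤ) =
      ∑ x : V, (1 - (if φ x = 0 then 1 else 0 : ℤ)) :=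
    Finset.sum_congr rfl fun x _ => by by_cases hx : φ x = 0 <;> simp [hx]
  rw [h2, Finset.sum_sub_distrib, mul_sub, h]
  simp
  ring

lemma sq_card_mul_sum_eq_zero_and (φ ψ : V →ₗ[F] F) (hφ : φ ≠ 0)
    (hψ : ∀ a : F, a • φ ≠ ψ) :
    (Fintype.card F : ℤ) ^ 2 *
      ∑ x, (if φ x = 0 then 1 else 0 : ℤ) * (if ψ x = 0 then 1 else 0 : ℤ) =
      Fintype.card V := by
  classical
  have hres : ψ.comp (LinearMap.ker φ).subtype ≠ 0 := by
    intro h0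
    have hle : ⨅ _ : Unit, LinearMap.ker φ ≤ LinearMap.ker ψ := by
      intro x hx
      have hx' : x ∈ LinearMap.ker φ := by simpa using hx
      simpa using LinearMap.congr_fun h0 ⟨x, hx'⟩
    have hmem := mem_span_of_iInf_ker_le_ker (L := fun _ : Unit => φ) hle
    rw [Set.range_const, Submodule.mem_span_singleton] at hmem
    obtain ⟨a, ha⟩ := hmem
    exact hψ a ha
  have h1 := card_mul_sum_eq_zero _ hres
  have h2 := card_mul_sum_eq_zero φ hφ
  rw [Finset.sum_boole] at h2
  have hcard : (Fintype.card (LinearMap.ker φ) : ℤ) = ({x | φ x = 0} : Finset V).card := by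
    rw [Fintype.card_subtype]
    simp [LinearMap.mem_ker]
  rw [← h2, ← hcard, ← h1, ← mul_assoc, pow_two]
  congr 1
  simp only [ite_mul, one_mul, zero_mul]
  rw [← Finset.sum_filter]
  exact (Finset.sum_subtype _ (by simp) _)

lemma sq_card_mul_sum_ne_zero_and (φ ψ : V →ₗ[F] F) (hφ : φ ≠ 0) (hψ0 : ψ ≠ 0)
    (hψ : ∀ a : F, a • φ ≠ ψ) :
    (Fintype.card F : ℤ) ^ 2 *
      ∑ x, (if φ x ≠ 0 then 1 else 0 : ℤ) * (if ψ x ≠ 0 then 1 else 0 : ℤ) =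
      (Fintype.card F - 1) ^ 2 * Fintype.card V := by
  have h1 := card_mul_sum_eq_zero φ hφ
  have h2 := card_mul_sum_eq_zero ψ hψ0
  have h3 := sq_card_mul_sum_eq_zero_and φ ψ hφ hψ
  have h4 : ∑ x, (if φ x ≠ 0 then 1 else 0 : ℤ) * (if ψ x ≠ 0 then 1 else 0 : ℤ) =
      ∑ x : V, (1 - (if φ x = 0 then 1 else 0 : ℤ) - (if ψ x = 0 then 1 else 0 : ℤ) +
        (if φ x = 0 then 1 else 0 : ℤ) * (if ψ x = 0 then 1 else 0 : ℤ)) :=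
    Finset.sum_congr rfl fun x _ => by
      by_cases hx : φ x = 0 <;> by_cases hy : ψ x = 0 <;> simp [hx, hy]
  rw [h4, Finset.sum_add_distrib, Finset.sum_sub_distrib, Finset.sum_sub_distrib]
  simp only [Finset.sum_const, Finset.card_univ, nsmul_eq_mul, mul_one]
  linear_combination -(Fintype.card F : ℤ) * h1 - (Fintype.card F : ℤ) * h2 + h3

omit [DecidableEq F] [Fintype V] in
lemma card_projectivization_dual [Fintype (ℙ F (Dual F V))] {k : ℕ} (hk : finrank F V = k) :
    Fintype.card (ℙ F (Dual F V)) = qrep (Fintype.card F) k := by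
  rw [← Nat.card_eq_fintype_card,
    Projectivization.card_of_finrank F _ ((Subspace.dual_finrank_eq).trans hk),
    Nat.card_eq_fintype_card, qrep]

omit [DecidableEq F] in
/-- The nonzero vectors are the unit multiples of the representatives of projective points. -/
lemma sum_eq_card_units_nsmul_sum_rep [Fintype (ℙ F V)] {A : Type*} [AddCommMonoid A]
    (f : V → A) (h0 : f 0 = 0) (hf : ∀ (c : Fˣ) v, f (c • v) = f v) :
    ∑ v, f v = (Fintype.card F - 1) • ∑ P : ℙ F V, f P.rep := by
  classical
  let g : Fˣ × ℙ F V → {v : V // v ≠ 0} := fun cP =>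
    ⟨cP.1 • cP.2.rep, (smul_ne_zero_iff_ne cP.1).2 cP.2.rep_nonzero⟩
  have hg : Function.Bijective g := by
    constructor
    · rintro ⟨c, P⟩ ⟨c', P'⟩ h
      have h1 : c • P.rep = c' • P'.rep := congrArg Subtype.val h
      have hP : P = P' := by
        rw [← P.mk_rep, ← P'.mk_rep, Projectivization.mk_eq_mk_iff]
        exact ⟨c⁻¹ * c', by rw [mul_smul, ← h1, inv_smul_smul]⟩
      subst hP
      have h2 : (c : F) = c' := smul_left_injective F P.rep_nonzero h1
      rw [Units.ext h2]
    · rintro ⟨v, hv⟩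
      obtain ⟨a, ha⟩ := Projectivization.exists_smul_eq_mk_rep F v hv
      exact ⟨(a⁻¹, Projectivization.mk F v hv), Subtype.ext (by simp [g, ← ha])⟩
  have h1 : ∑ v, f v = ∑ v : {v : V // v ≠ 0}, f v := by
    rw [← Finset.sum_subtype ({v : V | v ≠ 0} : Finset V) (by simp) f, Finset.sum_filter]
    refine Finset.sum_congr rfl fun v _ => ?_
    by_cases hv : v = 0 <;> simp [hv, h0]
  rw [h1, ← (Equiv.ofBijective g hg).sum_comp, Fintype.sum_prod_type]
  simp [g, hf, Fintype.card_units]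

omit [DecidableEq F] in
lemma sum_dual_mul_eq_zero [Fintype (Dual F V)]
    (hV : 2 < (Fintype.card F - 1) * finrank F V) (x y : V) :
    ∑ φ : Dual F V, φ x * φ y = 0 := by
  classical
  let b := Module.finBasis F V
  let l : V → MvPolynomial (Fin (finrank F V)) F := fun x =>
    ∑ i, MvPolynomial.C (b.equivFun x i) * MvPolynomial.X i
  have hl : ∀ x, (l x).totalDegree ≤ 1 := fun x =>
    (MvPolynomial.totalDegree_finsetSum _ _).trans <| Finset.sup_le fun i _ =>
      (MvPolynomial.totalDegree_mul _ _).trans (by simp)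
  have h := MvPolynomial.sum_eval_eq_zero (l x * l y) (by
    have := MvPolynomial.totalDegree_mul (l x) (l y)
    have := hl x
    have := hl y
    simp only [Fintype.card_fin]
    omega)
  rw [← h]
  refine (Fintype.sum_equiv (b.constr F (M' := F)).toEquiv _ _ fun a => ?_).symm
  simp [l, Basis.constr_apply_fintype]

variable [Fintype (Dual F V)] [Fintype (ℙ F (Dual F V))]

omit [DecidableEq F] in
lemma sum_rep_mul_eq_zero (hsq : ∀ c : F, c ≠ 0 → c * c = 1)
    (hV : 2 < (Fintype.card F - 1) * finrank F V) (x y : V) :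
    ∑ P : ℙ F (Dual F V), P.rep x * P.rep y = 0 := by
  have h := sum_eq_card_units_nsmul_sum_rep (F := F) (fun φ : Dual F V => φ x * φ y)
    (by simp) (fun c φ => by
      have := hsq c c.ne_zero
      simp only [Units.smul_def, LinearMap.smul_apply, smul_eq_mul]
      linear_combination (φ x * φ y) * this)
  rw [sum_dual_mul_eq_zero hV, nsmul_eq_mul, Nat.cast_sub Fintype.card_pos] at h
  simpa using h

lemma sum_rep_apply_ne_zero {k : ℕ} (hk : finrank F V = k + 1) {x : V} (hx : x ≠ 0) :
    ∑ P : ℙ F (Dual F V), (if P.rep x ≠ 0 then 1 else 0 : ℤ) = (Fintype.card F : ℤ) ^ k := by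
  have h := sum_eq_card_units_nsmul_sum_rep (F := F)
    (fun φ : Dual F V => if φ x ≠ 0 then (1 : ℤ) else 0)
    (by simp) (fun c φ => by simp [Units.smul_def])
  have h2 := card_mul_sum_ne_zero (Dual.eval F V x) (by
    intro h0
    exact hx ((Module.forall_dual_apply_eq_zero_iff F x).1 fun φ => LinearMap.congr_fun h0 φ))
  change (Fintype.card F : ℤ) * ∑ φ : Dual F V, (if φ x ≠ 0 then (1 : ℤ) else 0) = _ at h2
  rw [h, Module.card_eq_pow_finrank (K := F) (V := Dual F V), Subspace.dual_finrank_eq, hk,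
    nsmul_eq_mul, Nat.cast_sub Fintype.card_pos] at h2
  have hq : (1 : ℤ) < Fintype.card F := by exact_mod_cast Fintype.one_lt_card
  have hne : (Fintype.card F : ℤ) * (Fintype.card F - 1) ≠ 0 :=
    mul_ne_zero (by omega) (by omega)
  apply mul_left_cancel₀ hne
  push_cast at h2 ⊢
  linear_combination h2

end Counting

section Codes

open Module
open scoped LinearAlgebra.Projectivization

lemma wt_eq_sum {R : Type*} [Zero R] [DecidableEq R] {n : ℕ} (x : Fin n → R) :
    (wt x : ℤ) = ∑ i, (if x i ≠ 0 then 1 else 0 : ℤ) := by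
  rw [Finset.sum_boole, wt]

lemma isLCD_iff {R : Type*} [CommRing R] {n : ℕ} (C : Submodule R (Fin n → R)) :
    IsLCD C ↔ ∀ x ∈ C, (∀ y ∈ C, ∑ i, x i * y i = 0) → x = 0 := by
  rw [IsLCD, eq_bot_iff]
  exact ⟨fun h x hx hxy => (Submodule.mem_bot R).1 (h ⟨hx, hxy⟩),
    fun h x hx => (Submodule.mem_bot R).2 (h x hx.1 hx.2)⟩

/-- Two maps into a type whose fibers have equal cardinalities differ by a permutation. -/
lemma exists_perm_of_card_fiber_eq {ι α : Type*} [Fintype ι] [DecidableEq α] (f g : ι → α)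
    (h : ∀ a, ({i | f i = a} : Finset ι).card = ({i | g i = a} : Finset ι).card) :
    ∃ σ : Equiv.Perm ι, ∀ i, g (σ i) = f i := by
  have e : ∀ a, {i // f i = a} ≃ {i // g i = a} := fun a =>
    Fintype.equivOfCardEq (by rw [Fintype.card_subtype, Fintype.card_subtype, h a])
  refine ⟨((Equiv.sigmaFiberEquiv f).symm.trans (Equiv.sigmaCongrRight e)).trans
    (Equiv.sigmaFiberEquiv g), fun i => ?_⟩
  exact (e (f i) ⟨i, rfl⟩).2

lemma exists_map_card_fiber_eq {α : Type*} [Fintype α] [DecidableEq α] (μ : α → ℕ) {n : ℕ}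
    (h : ∑ a, μ a = n) :
    ∃ p : Fin n → α, ∀ a, ({i | p i = a} : Finset (Fin n)).card = μ a := by
  have e : Fin n ≃ Σ a, Fin (μ a) := Fintype.equivOfCardEq (by simp [h])
  refine ⟨fun i => (e i).1, fun a => ?_⟩
  rw [← Fintype.card_subtype, Fintype.card_congr
    ((e.subtypeEquiv fun i => Iff.rfl).trans (Equiv.sigmaSubtype a)), Fintype.card_fin]

lemma sum_comp_eq_sum_card_fiber {ι α A : Type*} [Fintype ι] [Fintype α] [DecidableEq α]
    [AddCommMonoid A] (p : ι → α) (g : α → A) :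
    ∑ i, g (p i) = ∑ a, ({i | p i = a} : Finset ι).card • g a := by
  rw [← Finset.sum_fiberwise' Finset.univ p g]
  simp

variable {F : Type*} [Field F] [DecidableEq F]

lemma dualDistGe_two_iff {n : ℕ} (C : Submodule F (Fin n → F)) :
    DualDistGe C 2 ↔ ∀ i, ∃ x ∈ C, x i ≠ 0 := by
  constructor
  · intro h i
    by_contra! hi
    have h1 := h (Pi.single i 1) (by
      intro y hy
      simp [Pi.single_apply, hi y hy]) (by simp)
    rw [wt, Finset.filter_congr (q := fun j => j = i) (by
      intro j _
      by_cases hj : j = i <;> simp [hj])] at h1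
    rw [Finset.filter_eq' Finset.univ i, if_pos (Finset.mem_univ i),
      Finset.card_singleton] at h1
    omega
  · intro h x hx hx0
    obtain ⟨i, hi⟩ := Function.ne_iff.1 hx0
    by_contra hlt
    have hone : ∀ j, x j ≠ 0 → j = i := fun j hj =>
      Finset.card_le_one.1 (show wt x ≤ 1 by omega) j (by simpa using hj) i (by simpa using hi)
    obtain ⟨y, hy, hyi⟩ := h i
    have hxy := hx y hy
    rw [Finset.sum_eq_single i (fun j _ hj => by
      rw [not_not.1 (mt (hone j) hj), zero_mul]) (by simp)] at hxy
    exact mul_ne_zero hi hyi hxy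

variable {V : Type*} [AddCommGroup V] [Module F V]

/-- The projective point of the dual space given by the `i`-th coordinate of a linear map. -/
noncomputable def coordPoint {n : ℕ} (L : V →ₗ[F] (Fin n → F)) (hL : ∀ i, ∃ x, L x i ≠ 0)
    (i : Fin n) : ℙ F (Dual F V) :=
  Projectivization.mk F ((LinearMap.proj i).comp L) fun h => by
    obtain ⟨x, hx⟩ := hL i
    exact hx (LinearMap.congr_fun h x)

omit [DecidableEq F] in
lemma exists_coordPoint_rep {n : ℕ} (L : V →ₗ[F] (Fin n → F)) (hL : ∀ i, ∃ x, L x i ≠ 0)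
    (i : Fin n) : ∃ c : F, c ≠ 0 ∧ ∀ x, (coordPoint L hL i).rep x = c * L x i := by
  obtain ⟨a, ha⟩ := Projectivization.exists_smul_eq_mk_rep F ((LinearMap.proj i).comp L)
    (fun h => by
      obtain ⟨x, hx⟩ := hL i
      exact hx (LinearMap.congr_fun h x))
  exact ⟨a, a.ne_zero, fun x => (LinearMap.congr_fun ha x).symm⟩

lemma wt_eq_sum_coordPoint {n : ℕ} (L : V →ₗ[F] (Fin n → F)) (hL : ∀ i, ∃ x, L x i ≠ 0)
    (x : V) : (wt (L x) : ℤ) = ∑ i, (if (coordPoint L hL i).rep x ≠ 0 then 1 else 0 : ℤ) := by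
  rw [wt_eq_sum]
  refine Finset.sum_congr rfl fun i _ => ?_
  obtain ⟨c, hc, h⟩ := exists_coordPoint_rep L hL i
  simp [h, hc]

omit [DecidableEq F] in
lemma sum_mul_eq_sum_coordPoint (hsq : ∀ c : F, c ≠ 0 → c * c = 1) {n : ℕ}
    (L : V →ₗ[F] (Fin n → F)) (hL : ∀ i, ∃ x, L x i ≠ 0) (x y : V) :
    ∑ i, L x i * L y i = ∑ i, (coordPoint L hL i).rep x * (coordPoint L hL i).rep y := by
  refine Finset.sum_congr rfl fun i _ => ?_
  obtain ⟨c, hc, h⟩ := exists_coordPoint_rep L hL i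
  rw [h, h]
  linear_combination -(L x i * L y i) * hsq c hc

/-- A double count over the vectors off a hyperplane, expressing the multiplicity of a point by
the weights. -/
lemma sum_weight_off_hyperplane [Fintype F] [Fintype V] [DecidableEq (ℙ F (Dual F V))] {n : ℕ}
    (p : Fin n → ℙ F (Dual F V)) (P : ℙ F (Dual F V)) :
    (Fintype.card F : ℤ) ^ 2 * ∑ x, (if P.rep x ≠ 0 then 1 else 0 : ℤ) *
        ∑ i, (if (p i).rep x ≠ 0 then 1 else 0 : ℤ) =
      (Fintype.card F - 1) * Fintype.card V *
        (({i | p i = P} : Finset (Fin n)).card + (Fintype.card F - 1) * n) := by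
  have hterm : ∀ i, (Fintype.card F : ℤ) ^ 2 * ∑ x, (if P.rep x ≠ 0 then 1 else 0 : ℤ) *
      (if (p i).rep x ≠ 0 then 1 else 0 : ℤ) =
      (Fintype.card F - 1) * Fintype.card V *
        ((if p i = P then 1 else 0) + (Fintype.card F - 1)) := by
    intro i
    by_cases hi : p i = P
    · have h := card_mul_sum_ne_zero P.rep P.rep_nonzero
      rw [hi, if_pos rfl]
      simp only [mul_ite, mul_one, mul_zero]
      rw [Finset.sum_congr rfl (g := fun x => if P.rep x ≠ 0 then (1 : ℤ) else 0)
        (fun x _ => by by_cases hx : P.rep x = 0 <;> simp [hx])]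
      linear_combination (Fintype.card F : ℤ) * h
    · rw [if_neg hi, sq_card_mul_sum_ne_zero_and _ _ P.rep_nonzero (p i).rep_nonzero]
      · ring
      · intro a ha
        apply hi
        rw [← (p i).mk_rep, ← P.mk_rep, Projectivization.mk_eq_mk_iff']
        exact ⟨a, ha⟩
  simp_rw [Finset.mul_sum] at hterm ⊢
  rw [Finset.sum_comm, Finset.sum_congr rfl fun i _ => hterm i, ← Finset.mul_sum,
    Finset.sum_add_distrib, Finset.sum_boole, Finset.sum_const, Finset.card_univ,
    Fintype.card_fin, nsmul_eq_mul]
  ring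

lemma card_fiber_coordPoint_ge [Fintype F] [Finite V] [DecidableEq (ℙ F (Dual F V))] {n d : ℕ}
    (L : V →ₗ[F] (Fin n → F)) (hL : ∀ i, ∃ x, L x i ≠ 0)
    (hd : ∀ x, x ≠ 0 → d ≤ wt (L x)) (P : ℙ F (Dual F V)) :
    (Fintype.card F : ℤ) * d - (Fintype.card F - 1) * n ≤
      ({i | coordPoint L hL i = P} : Finset (Fin n)).card := by
  have := Fintype.ofFinite V
  have h := sum_weight_off_hyperplane (coordPoint L hL) P
  have h1 := card_mul_sum_ne_zero P.rep P.rep_nonzero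
  have hle : (∑ x, (if P.rep x ≠ 0 then 1 else 0 : ℤ)) * d ≤
      ∑ x, (if P.rep x ≠ 0 then 1 else 0 : ℤ) *
        ∑ i, (if (coordPoint L hL i).rep x ≠ 0 then 1 else 0 : ℤ) := by
    rw [Finset.sum_mul]
    refine Finset.sum_le_sum fun x _ => ?_
    rw [← wt_eq_sum_coordPoint]
    by_cases hx : P.rep x = 0
    · simp [hx]
    · have hx0 : x ≠ 0 := fun h0 => hx (by simp [h0])
      simpa [hx] using hd x hx0
  have hq : (1 : ℤ) < Fintype.card F := by exact_mod_cast Fintype.one_lt_card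
  have hV : (0 : ℤ) < Fintype.card V := by exact_mod_cast Fintype.card_pos
  have h2 := mul_le_mul_of_nonneg_left hle (sq_nonneg (Fintype.card F : ℤ))
  have hpos : (0 : ℤ) < (Fintype.card F - 1) * Fintype.card V := mul_pos (by omega) hV
  rw [h] at h2
  have h3 : ((Fintype.card F : ℤ) - 1) * Fintype.card V * (Fintype.card F * d) ≤
      (Fintype.card F - 1) * Fintype.card V *
        (({i | coordPoint L hL i = P} : Finset (Fin n)).card + (Fintype.card F - 1) * n) := by
    refine le_trans (le_of_eq ?_) h2
    linear_combination -((Fintype.card F : ℤ) * d) * h1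
  have := le_of_mul_le_mul_left h3 hpos
  linarith

/-- The MacWilliams extension theorem for maps without zero coordinates. -/
lemma codeEquiv_range_of_wt_eq [Fintype F] [Finite V] {n : ℕ} (L₁ L₂ : V →ₗ[F] (Fin n → F))
    (hL₁ : ∀ i, ∃ x, L₁ x i ≠ 0) (hL₂ : ∀ i, ∃ x, L₂ x i ≠ 0)
    (hwt : ∀ x, wt (L₁ x) = wt (L₂ x)) :
    codeEquiv (LinearMap.range L₁) (LinearMap.range L₂) := by
  classical
  have := Fintype.ofFinite V
  have hq : (1 : ℤ) < Fintype.card F := by exact_mod_cast Fintype.one_lt_card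
  have hV : (0 : ℤ) < Fintype.card V := by exact_mod_cast Fintype.card_pos
  have hpos : ((Fintype.card F : ℤ) - 1) * Fintype.card V ≠ 0 :=
    (mul_pos (by omega) hV).ne'
  obtain ⟨σ, hσ⟩ := exists_perm_of_card_fiber_eq (coordPoint L₁ hL₁) (coordPoint L₂ hL₂) (by
    intro P
    have h1 := sum_weight_off_hyperplane (coordPoint L₁ hL₁) P
    have h2 := sum_weight_off_hyperplane (coordPoint L₂ hL₂) P
    simp_rw [← wt_eq_sum_coordPoint, hwt] at h1
    simp_rw [← wt_eq_sum_coordPoint] at h2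
    rw [h1] at h2
    have := mul_left_cancel₀ hpos h2
    exact_mod_cast add_right_cancel this)
  choose c₁ hc₁ h₁ using exists_coordPoint_rep L₁ hL₁
  choose c₂ hc₂ h₂ using exists_coordPoint_rep L₂ hL₂
  have hc : ∀ i x, L₂ x (σ i) = (c₁ i / c₂ (σ i)) * L₁ x i := by
    intro i x
    have := h₂ (σ i) x
    rw [hσ, h₁] at this
    field_simp [hc₂ (σ i)]
    linear_combination -this
  refine ⟨Matrix.of fun i j => if σ i = j then c₁ i / c₂ (σ i) else 0,
    ⟨σ, fun i => c₁ i / c₂ (σ i), fun i => div_ne_zero (hc₁ i) (hc₂ _), fun _ _ => rfl⟩, ?_⟩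
  rw [← LinearMap.range_comp]
  congr 1
  ext x j
  obtain ⟨i, rfl⟩ := σ.surjective j
  simp [Matrix.vecMul, dotProduct, hc, mul_comm]

lemma codeEquiv_iff_exists_linearEquiv [Fintype F] {n : ℕ} {C₁ C₂ : Submodule F (Fin n → F)}
    (h₁ : DualDistGe C₁ 2) (h₂ : DualDistGe C₂ 2) :
    codeEquiv C₁ C₂ ↔ ∃ e : C₁ ≃ₗ[F] C₂, ∀ x, wt (e x : Fin n → F) = wt (x : Fin n → F) := by
  rw [dualDistGe_two_iff] at h₁ h₂
  constructor
  · rintro ⟨P, ⟨σ, c, hc, hP⟩, rfl⟩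
    have happ : ∀ (x : Fin n → F) i, Matrix.vecMulLinear P x (σ i) = x i * c i := by
      intro x i
      simp [Matrix.vecMul, dotProduct, hP]
    have hinj : Function.Injective (Matrix.vecMulLinear P) := by
      intro x y hxy
      ext i
      have := congrFun hxy (σ i)
      rw [happ, happ] at this
      exact mul_right_cancel₀ (hc i) this
    refine ⟨Submodule.equivMapOfInjective _ hinj C₁, fun x => ?_⟩
    rw [Submodule.coe_equivMapOfInjective_apply]
    zify
    rw [wt_eq_sum, wt_eq_sum, ← Equiv.sum_comp σ]
    simp only [happ]
    simp [hc]
  · rintro ⟨e, he⟩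
    have h := codeEquiv_range_of_wt_eq C₁.subtype (C₂.subtype.comp e.toLinearMap)
      (fun i => by
        obtain ⟨x, hx, hxi⟩ := h₁ i
        exact ⟨⟨x, hx⟩, hxi⟩)
      (fun i => by
        obtain ⟨x, hx, hxi⟩ := h₂ i
        exact ⟨e.symm ⟨x, hx⟩, by simpa using hxi⟩)
      (fun x => (he x).symm)
    rwa [LinearMap.range_comp_of_range_eq_top _ e.range, Submodule.range_subtype,
      Submodule.range_subtype] at h

/-- Changing the multiplicity of every projective coordinate point by a constant shifts the
weights of the nonzero codewords by a constant and preserves the LCD property. -/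
lemma exists_code_shift [Fintype F] (hsq : ∀ c : F, c ≠ 0 → c * c = 1) {n n' k : ℕ} (δ : ℤ)
    (hk : 2 < (Fintype.card F - 1) * (k + 1)) (C : Submodule F (Fin n → F))
    (hC : finrank F C = k + 1) (hLCD : IsLCD C) (hdual : ∀ i, ∃ x : C, C.subtype x i ≠ 0)
    (hδ : ∀ P, 0 ≤ (Nat.card {i // coordPoint C.subtype hdual i = P} : ℤ) + δ)
    (hn : (n' : ℤ) = n + δ * qrep (Fintype.card F) (k + 1))
    (hwt : ∀ x : C, x ≠ 0 → 0 < (wt (x : Fin n → F) : ℤ) + δ * (Fintype.card F : ℤ) ^ k) :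
    ∃ C' : Submodule F (Fin n' → F), finrank F C' = k + 1 ∧ IsLCD C' ∧ DualDistGe C' 2 ∧
      ∃ e : C ≃ₗ[F] C', ∀ x, x ≠ 0 → (wt (e x : Fin n' → F) : ℤ) =
        wt (x : Fin n → F) + δ * (Fintype.card F : ℤ) ^ k := by
  classical
  have := Fintype.ofFinite C
  have : Finite (Dual F C) := Module.finite_of_finite F
  have := Fintype.ofFinite (Dual F C)
  have := Fintype.ofFinite (ℙ F (Dual F C))
  set p := coordPoint C.subtype hdual with hp
  set m : ℙ F (Dual F C) → ℕ := fun P => ({i | p i = P} : Finset (Fin n)).card with hm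
  have hμ : ∀ P, (((m P + δ).toNat : ℕ) : ℤ) = m P + δ := fun P => by
    have := hδ P
    rw [Nat.card_eq_fintype_card, Fintype.card_subtype] at this
    exact Int.toNat_of_nonneg this
  obtain ⟨p', hp'⟩ := exists_map_card_fiber_eq (n := n') (fun P => (m P + δ).toNat) (by
    have h1 := sum_comp_eq_sum_card_fiber p (fun _ => (1 : ℤ))
    zify
    simp_rw [hμ]
    rw [Finset.sum_add_distrib, hn]
    simp only [hm, Finset.sum_const, Finset.card_univ, nsmul_eq_mul, mul_one,
      Fintype.card_fin] at h1 ⊢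
    rw [h1, card_projectivization_dual hC]
    ring)
  let L : C →ₗ[F] (Fin n' → F) := LinearMap.pi fun i => (p' i).rep
  have hwtL : ∀ x, x ≠ 0 → (wt (L x) : ℤ) =
      wt (x : Fin n → F) + δ * (Fintype.card F : ℤ) ^ k := by
    intro x hx
    have h1 := sum_comp_eq_sum_card_fiber p (fun P => if P.rep x ≠ 0 then (1 : ℤ) else 0)
    have h2 := sum_comp_eq_sum_card_fiber p' (fun P => if P.rep x ≠ 0 then (1 : ℤ) else 0)
    have h3 := wt_eq_sum_coordPoint C.subtype hdual x
    rw [← hp, h1] at h3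
    have h4 : (wt (L x) : ℤ) = ∑ i, (if (p' i).rep x ≠ 0 then 1 else 0 : ℤ) := wt_eq_sum _
    rw [h4, h2, ← sum_rep_apply_ne_zero hC hx, Submodule.subtype_apply] at *
    rw [h3, Finset.mul_sum, ← Finset.sum_add_distrib]
    refine Finset.sum_congr rfl fun P _ => ?_
    rw [hp', nsmul_eq_mul, nsmul_eq_mul, hμ, add_mul]
  have hinj : Function.Injective L := by
    rw [← LinearMap.ker_eq_bot, LinearMap.ker_eq_bot']
    intro x hx
    by_contra hx0
    have h1 := hwtL x hx0
    have h2 := hwt x hx0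
    rw [← h1, hx] at h2
    simp [wt] at h2
  have hform : ∀ x y, ∑ i, L x i * L y i = ∑ i, (x : Fin n → F) i * (y : Fin n → F) i := by
    intro x y
    have h1 := sum_comp_eq_sum_card_fiber p (fun P => P.rep x * P.rep y)
    have h2 := sum_comp_eq_sum_card_fiber p' (fun P => P.rep x * P.rep y)
    have h3 := sum_mul_eq_sum_coordPoint hsq C.subtype hdual x y
    have h4 := sum_rep_mul_eq_zero hsq (by rwa [hC]) x y
    calc ∑ i, L x i * L y i
        = ∑ P : ℙ F (Dual F C), ((m P : F) + (δ : F)) * (P.rep x * P.rep y) := by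
          refine h2.trans (Finset.sum_congr rfl fun P _ => ?_)
          rw [hp', nsmul_eq_mul]
          congr 1
          exact_mod_cast congrArg (Int.cast (R := F)) (hμ P)
      _ = ∑ P, m P • (P.rep x * P.rep y) := by
          simp_rw [add_mul]
          rw [Finset.sum_add_distrib, ← Finset.mul_sum, h4, mul_zero, add_zero]
          simp_rw [nsmul_eq_mul]
      _ = _ := (h3.trans h1).symm
  let e := LinearEquiv.ofInjective L hinj
  refine ⟨LinearMap.range L, e.finrank_eq.symm.trans hC, ?_, ?_, e, fun x hx => hwtL x hx⟩
  · rw [isLCD_iff] at hLCD ⊢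
    rintro _ ⟨x, rfl⟩ hx
    have : x = 0 := Subtype.ext <| hLCD x x.2 fun y hy => by
      rw [← hform x ⟨y, hy⟩]
      exact hx _ ⟨_, rfl⟩
    rw [this, map_zero]
  · rw [dualDistGe_two_iff]
    intro i
    by_contra! h
    exact (p' i).rep_nonzero (LinearMap.ext fun x => h _ ⟨x, rfl⟩)

end Codes

section Bijection

open Module

lemma cast_qrep_mul_sub_one (q k : ℕ) : (qrep q k : ℤ) * ((q : ℤ) - 1) = (q : ℤ) ^ k - 1 := by
  rw [qrep]
  push_cast
  exact geom_sum_mul _ _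

variable {F : Type*} [Field F] [DecidableEq F]

lemma hasMinWeight_of_linearEquiv {n n' d d' : ℕ} {δ : ℤ} {C : Submodule F (Fin n → F)}
    {C' : Submodule F (Fin n' → F)} (e : C ≃ₗ[F] C')
    (he : ∀ x, x ≠ 0 → (wt (e x : Fin n' → F) : ℤ) = wt (x : Fin n → F) + δ)
    (hd : (d' : ℤ) = d + δ) (h : HasMinWeight C d) : HasMinWeight C' d' := by
  obtain ⟨⟨x, hx, hx0, hxd⟩, hmin⟩ := h
  constructor
  · have hne : (⟨x, hx⟩ : C) ≠ 0 := fun h0 => hx0 (congrArg Subtype.val h0)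
    refine ⟨e ⟨x, hx⟩, (e _).2, fun h0 => hne (e.map_eq_zero_iff.1 (Subtype.ext h0)), ?_⟩
    have := he _ hne
    simp only [hxd] at this
    omega
  · intro y hy hy0
    have hne : e.symm ⟨y, hy⟩ ≠ 0 := fun h0 =>
      hy0 (congrArg Subtype.val (e.symm.map_eq_zero_iff.1 h0))
    have h1 := he _ hne
    have h2 := hmin (e.symm ⟨y, hy⟩) (e.symm ⟨y, hy⟩).2 fun h0 => hne (Subtype.ext h0)
    rw [e.apply_symm_apply] at h1
    dsimp only at h1
    omega

lemma wt_linearEquiv_of_shift {n₁ n₂ n₁' n₂' : ℕ} {δ : ℤ} {C₁ : Submodule F (Fin n₁ → F)}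
    {C₂ : Submodule F (Fin n₂ → F)} {C₁' : Submodule F (Fin n₁' → F)}
    {C₂' : Submodule F (Fin n₂' → F)} (e₁ : C₁ ≃ₗ[F] C₁') (e₂ : C₂ ≃ₗ[F] C₂')
    (h₁ : ∀ x, x ≠ 0 → (wt (e₁ x : Fin n₁' → F) : ℤ) = wt (x : Fin n₁ → F) + δ)
    (h₂ : ∀ x, x ≠ 0 → (wt (e₂ x : Fin n₂' → F) : ℤ) = wt (x : Fin n₂ → F) + δ)
    (e : C₁ ≃ₗ[F] C₂) (he : ∀ x, wt (e x : Fin n₂ → F) = wt (x : Fin n₁ → F)) (y : C₁') :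
    wt (((e₁.symm.trans e).trans e₂) y : Fin n₂' → F) = wt (y : Fin n₁' → F) := by
  obtain ⟨x, rfl⟩ := e₁.surjective y
  by_cases hx : x = 0
  · subst hx
    simp [wt]
  · have h3 := h₁ x hx
    have h4 := h₂ (e x) (fun h0 => hx (e.map_eq_zero_iff.1 h0))
    rw [he] at h4
    simp only [LinearEquiv.trans_apply, LinearEquiv.symm_apply_apply]
    omega

lemma shift_symm {n n' : ℕ} {δ : ℤ} {C : Submodule F (Fin n → F)}
    {C' : Submodule F (Fin n' → F)} (e : C ≃ₗ[F] C')
    (he : ∀ x, x ≠ 0 → (wt (e x : Fin n' → F) : ℤ) = wt (x : Fin n → F) + δ) (y : C')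
    (hy : y ≠ 0) : (wt (e.symm y : Fin n → F) : ℤ) = wt (y : Fin n' → F) + -δ := by
  have h := he (e.symm y) (fun h0 => hy (e.symm.map_eq_zero_iff.1 h0))
  rw [e.apply_symm_apply] at h
  omega

theorem exists_classBijection_of_sq_eq_one [Fintype F] (hsq : ∀ c : F, c ≠ 0 → c * c = 1)
    {q k n d r : ℕ} (hq : Fintype.card F = q) (hk : 2 < (q - 1) * k)
    (hd : 1 ≤ (q : ℤ) * d - ((q : ℤ) - 1) * n)
    (hr : (r : ℤ) = (q : ℤ) ^ (k - 1) * n - (qrep q k : ℤ) * d) (hqr : k ≤ q * r) :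
    ∃ f : {C : Submodule F (Fin n → F) //
            finrank F C = k ∧ IsLCD C ∧ HasMinWeight C d ∧ DualDistGe C 2} →
          {C : Submodule F (Fin (q * r) → F) //
            finrank F C = k ∧ IsLCD C ∧ HasMinWeight C ((q - 1) * r) ∧ DualDistGe C 2},
      (∀ C₁ C₂, codeEquiv C₁.1 C₂.1 ↔ codeEquiv (f C₁).1 (f C₂).1) ∧
      ∀ D : {C : Submodule F (Fin (q * r) → F) //
            finrank F C = k ∧ IsLCD C ∧ HasMinWeight C ((q - 1) * r) ∧ DualDistGe C 2},
        ∃ C, codeEquiv (f C).1 D.1 := by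
  classical
  subst hq
  obtain ⟨k, rfl⟩ : ∃ j, k = j + 1 :=
    Nat.exists_eq_succ_of_ne_zero (by rintro rfl; simp at hk)
  rw [Nat.add_sub_cancel] at hr
  have hq1 : 1 < Fintype.card F := Fintype.one_lt_card
  have hrpos : 0 < r := Nat.pos_of_ne_zero (by rintro rfl; simp at hqr)
  have hrep := cast_qrep_mul_sub_one (Fintype.card F) (k + 1)
  set q := Fintype.card F with hqdef
  set s : ℤ := (q : ℤ) * d - ((q : ℤ) - 1) * n with hs
  have hlen : ((q * r : ℕ) : ℤ) = n + -s * qrep q (k + 1) := by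
    push_cast
    rw [hs]
    linear_combination (q : ℤ) * hr - (n : ℤ) * hrep
  have hcast : (((q - 1) * r : ℕ) : ℤ) = ((q : ℤ) - 1) * r := by
    push_cast [Nat.cast_sub hq1.le]
    rfl
  have hmin : (((q - 1) * r : ℕ) : ℤ) = d + -s * (q : ℤ) ^ k := by
    rw [hcast, hs]
    linear_combination ((q : ℤ) - 1) * hr - (d : ℤ) * hrep
  have hminpos : 0 < (q - 1) * r := Nat.mul_pos (by omega) hrpos
  have hforward : ∀ C : {C : Submodule F (Fin n → F) //
      finrank F C = k + 1 ∧ IsLCD C ∧ HasMinWeight C d ∧ DualDistGe C 2},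
      ∃ C' : {C : Submodule F (Fin (q * r) → F) //
        finrank F C = k + 1 ∧ IsLCD C ∧ HasMinWeight C ((q - 1) * r) ∧ DualDistGe C 2},
      ∃ e : C.1 ≃ₗ[F] C'.1, ∀ x, x ≠ 0 → (wt (e x : Fin (q * r) → F) : ℤ) =
        wt (x : Fin n → F) + -s * (q : ℤ) ^ k := by
    rintro ⟨C, hfin, hLCD, hw, hdual⟩
    have hcoord : ∀ i, ∃ x : C, C.subtype x i ≠ 0 := fun i => by
      obtain ⟨x, hx, hxi⟩ := (dualDistGe_two_iff C).1 hdual i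
      exact ⟨⟨x, hx⟩, hxi⟩
    have hle : ∀ x : C, x ≠ 0 → d ≤ wt (x : Fin n → F) := fun x hx =>
      hw.2 x x.2 fun h0 => hx (Subtype.ext h0)
    obtain ⟨C', h1, h2, h3, e, he⟩ := exists_code_shift hsq (-s) hk C hfin hLCD hcoord
      (fun P => by
        have := card_fiber_coordPoint_ge C.subtype hcoord hle P
        rw [Nat.card_eq_fintype_card, Fintype.card_subtype]
        linarith) hlen
      (fun x hx => by
        have := hle x hx
        rw [← hqdef]
        omega)
    exact ⟨⟨C', h1, h2, hasMinWeight_of_linearEquiv e he hmin hw, h3⟩, e, he⟩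
  have hbackward : ∀ D : {C : Submodule F (Fin (q * r) → F) //
      finrank F C = k + 1 ∧ IsLCD C ∧ HasMinWeight C ((q - 1) * r) ∧ DualDistGe C 2},
      ∃ C : {C : Submodule F (Fin n → F) //
        finrank F C = k + 1 ∧ IsLCD C ∧ HasMinWeight C d ∧ DualDistGe C 2},
      ∃ e : D.1 ≃ₗ[F] C.1, ∀ x, x ≠ 0 → (wt (e x : Fin n → F) : ℤ) =
        wt (x : Fin (q * r) → F) + s * (q : ℤ) ^ k := by
    rintro ⟨D, hfin, hLCD, hw, hdual⟩
    have hcoord : ∀ i, ∃ x : D, D.subtype x i ≠ 0 := fun i => by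
      obtain ⟨x, hx, hxi⟩ := (dualDistGe_two_iff D).1 hdual i
      exact ⟨⟨x, hx⟩, hxi⟩
    obtain ⟨C, h1, h2, h3, e, he⟩ := exists_code_shift (n' := n) hsq s hk D hfin hLCD hcoord
      (fun P => by positivity) (by rw [hlen]; ring)
      (fun x hx => by
        have := hw.2 x x.2 fun h0 => hx (Subtype.ext h0)
        have : 0 < (wt (x : Fin (q * r) → F) : ℤ) := by omega
        positivity)
    exact ⟨⟨C, h1, h2, hasMinWeight_of_linearEquiv e he (by rw [← hqdef, hmin]; ring) hw, h3⟩,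
      e, he⟩
  choose f e he using hforward
  refine ⟨f, fun C₁ C₂ => ?_, fun D => ?_⟩
  · rw [codeEquiv_iff_exists_linearEquiv C₁.2.2.2.2 C₂.2.2.2.2,
      codeEquiv_iff_exists_linearEquiv (f C₁).2.2.2.2 (f C₂).2.2.2.2]
    constructor
    · rintro ⟨g, hg⟩
      exact ⟨_, wt_linearEquiv_of_shift (e C₁) (e C₂) (he C₁) (he C₂) g hg⟩
    · rintro ⟨g, hg⟩
      exact ⟨_, wt_linearEquiv_of_shift (e C₁).symm (e C₂).symm (shift_symm _ (he C₁))
        (shift_symm _ (he C₂)) g hg⟩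
  · obtain ⟨C, g, hg⟩ := hbackward D
    simp only [neg_mul] at he
    have hg' := shift_symm g hg
    exact ⟨C, (codeEquiv_iff_exists_linearEquiv (f C).2.2.2.2 D.2.2.2.2).2
      ⟨_, wt_linearEquiv_of_shift (e C) g.symm (he C) hg' (LinearEquiv.refl F C.1)
        fun _ => rfl⟩⟩

end Bijection

/-- There is a one-to-one correspondence between equivalence classes of LCD `[n,k,d]`
codes over `𝔽_q` with dual distance `≥ 2` and equivalence classes of LCD
`[q·r, k, (q−1)·r]` codes with dual distance `≥ 2`, where `r = r_{q,n,k,d}`. -/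
theorem class_bijection {q k₀ k n d r : ℕ}
    (hq : (q = 2 ∧ k₀ = 3) ∨ (q = 3 ∧ k₀ = 2)) (hk : k₀ ≤ k)
    (hd : 1 ≤ (q : ℤ) * d - ((q : ℤ) - 1) * n)
    (hr : (r : ℤ) = (q : ℤ) ^ (k - 1) * n - (qrep q k : ℤ) * d)
    (hqr : k ≤ q * r) :
    ∃ f : {C : Submodule (ZMod q) (Fin n → ZMod q) //
            Module.finrank (ZMod q) C = k ∧ IsLCD C ∧ HasMinWeight C d ∧ DualDistGe C 2} →
          {C : Submodule (ZMod q) (Fin (q * r) → ZMod q) //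
            Module.finrank (ZMod q) C = k ∧ IsLCD C ∧ HasMinWeight C ((q - 1) * r) ∧
            DualDistGe C 2},
      (∀ C₁ C₂, codeEquiv C₁.1 C₂.1 ↔ codeEquiv (f C₁).1 (f C₂).1) ∧
      (∀ D : {C : Submodule (ZMod q) (Fin (q * r) → ZMod q) //
            Module.finrank (ZMod q) C = k ∧ IsLCD C ∧ HasMinWeight C ((q - 1) * r) ∧
            DualDistGe C 2},
        ∃ C, codeEquiv (f C).1 D.1) := by
  rcases hq with ⟨rfl, rfl⟩ | ⟨rfl, rfl⟩
  · exact exists_classBijection_of_sq_eq_one (by decide) (ZMod.card 2) (by omega) hd hr hqr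
  · exact exists_classBijection_of_sq_eq_one (by decide) (ZMod.card 3) (by omega) hd hr hqr
end

section
/- Suppose (q,k₀) ∈ {(2,3),(3,2)}, k ≥ k₀, q·d − (q−1)·n ≥ 1 and q·r_{q,n,k,d} ≥ k, where r_{q,n,k,d} = q^{k−1}·n − [k]_q·d. If there is no LCD [q·r_{q,n,k,d}, k, (q−1)·r_{q,n,k,d}] code over 𝔽_q with dual distance d⊥ ≥ 2, then there is no LCD [n,k,d] code over 𝔽_q. -/
open Matrix Finset

open scoped LinearAlgebra.Projectivization

section TwoFunctionals

variable {K : Type*} [Field K] {k : ℕ}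

/-- If `b` is not a multiple of `a ≠ 0`, some vector is orthogonal to `a` but not to `b`. -/
lemma exists_dotProduct_eq_zero_eq_one {a b : Fin k → K} (ha : a ≠ 0)
    (hab : ∀ c : K, b ≠ c • a) : ∃ v : Fin k → K, v ⬝ᵥ a = 0 ∧ v ⬝ᵥ b = 1 := by
  obtain ⟨i, hi⟩ := Function.ne_iff.mp ha
  rw [Pi.zero_apply] at hi
  obtain ⟨j, hj⟩ := Function.ne_iff.mp (hab (b i / a i))
  have hne : a i * b j - a j * b i ≠ 0 := by
    intro h
    apply hj
    simp only [Pi.smul_apply, smul_eq_mul]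
    field_simp
    linear_combination h
  refine ⟨(a i * b j - a j * b i)⁻¹ • (Pi.single j (a i) - Pi.single i (a j)), ?_, ?_⟩
  · simp [sub_dotProduct, single_dotProduct, mul_comm]
  · rw [smul_dotProduct, sub_dotProduct, single_dotProduct, single_dotProduct, smul_eq_mul,
      inv_mul_cancel₀ hne]

variable [Fintype K] [DecidableEq K]

/-- A set of vectors invariant under translation by a vector `v₀` with `v₀ ⬝ᵥ b = 1` is
equidistributed with respect to `v ↦ v ⬝ᵥ b`. -/
lemma card_mul_card_dotProduct_ne_zero (P : (Fin k → K) → Prop) [DecidablePred P]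
    {b v₀ : Fin k → K} (hb : v₀ ⬝ᵥ b = 1) (hP : ∀ (c : K) v, P (v + c • v₀) ↔ P v) :
    (Fintype.card K : ℤ) * #{v : Fin k → K | P v ∧ v ⬝ᵥ b ≠ 0} =
      (Fintype.card K - 1) * #{v : Fin k → K | P v} := by
  have hfib : ∀ c : K, #{v : Fin k → K | P v ∧ v ⬝ᵥ b = c} =
      #{v : Fin k → K | P v ∧ v ⬝ᵥ b = 0} := by
    intro c
    refine card_equiv (Equiv.addRight ((-c) • v₀)) fun v => ?_
    simp only [mem_filter_univ, Equiv.coe_addRight, hP, add_dotProduct, smul_dotProduct, hb,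
      smul_eq_mul, mul_one, ← sub_eq_add_neg, sub_eq_zero]
  have htot : #{v : Fin k → K | P v} =
      Fintype.card K * #{v : Fin k → K | P v ∧ v ⬝ᵥ b = 0} := by
    rw [card_eq_sum_card_fiberwise (f := fun v => v ⬝ᵥ b) (t := univ) (by simp [Set.MapsTo])]
    simp only [filter_filter, hfib, sum_const, card_univ, smul_eq_mul]
  have hsplit := card_filter_add_card_filter_not (s := {v : Fin k → K | P v})
    (fun v : Fin k → K => v ⬝ᵥ b = 0)
  simp only [filter_filter] at hsplit
  zify at hsplit htot
  linear_combination (Fintype.card K : ℤ) * hsplit + htot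

/-- The number of vectors not orthogonal to a nonzero vector. -/
lemma card_mul_card_not_orthogonal {b : Fin k → K} (hb : b ≠ 0) :
    (Fintype.card K : ℤ) * #{v : Fin k → K | v ⬝ᵥ b ≠ 0} =
      (Fintype.card K - 1) * Fintype.card K ^ k := by
  obtain ⟨i, hi⟩ := Function.ne_iff.mp hb
  have h := card_mul_card_dotProduct_ne_zero (fun _ : Fin k → K => True) (b := b)
    (v₀ := Pi.single i (b i)⁻¹) (by simpa using inv_mul_cancel₀ hi) (by simp)
  simpa using h

/-- The number of vectors orthogonal to neither of two independent vectors. -/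
lemma card_mul_card_not_orthogonal_pair {a b : Fin k → K} (ha : a ≠ 0)
    (hab : ∀ c : K, b ≠ c • a) :
    (Fintype.card K : ℤ) * #{v : Fin k → K | v ⬝ᵥ a ≠ 0 ∧ v ⬝ᵥ b ≠ 0} =
      (Fintype.card K - 1) * #{v : Fin k → K | v ⬝ᵥ a ≠ 0} := by
  obtain ⟨v₀, h₀, h₁⟩ := exists_dotProduct_eq_zero_eq_one ha hab
  exact card_mul_card_dotProduct_ne_zero (fun v => v ⬝ᵥ a ≠ 0) h₁ fun c v => by
    simp [add_dotProduct, h₀]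

omit [DecidableEq K] in
/-- If `2 < (q - 1) k`, the quadratic form `v ↦ (v ⬝ᵥ x) (v ⬝ᵥ y)` sums to zero over `K ^ k`. -/
lemma sum_dotProduct_mul_dotProduct_eq_zero (hk : 2 < (Fintype.card K - 1) * k)
    (x y : Fin k → K) : ∑ v : Fin k → K, (v ⬝ᵥ x) * (v ⬝ᵥ y) = 0 := by
  let L (x : Fin k → K) : MvPolynomial (Fin k) K := ∑ i, MvPolynomial.X i * MvPolynomial.C (x i)
  have hL (x : Fin k → K) : (L x).totalDegree ≤ 1 :=
    MvPolynomial.totalDegree_finsetSum_le fun i _ =>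
      (MvPolynomial.totalDegree_mul _ _).trans (by simp)
  have h := MvPolynomial.sum_eval_eq_zero (L x * L y) <|
    ((MvPolynomial.totalDegree_mul _ _).trans (add_le_add (hL x) (hL y))).trans_lt
      (by simpa using hk)
  simpa [L, dotProduct] using h

end TwoFunctionals

section ProjectiveSums

variable {K V : Type*} [Field K] [AddCommGroup V] [Module K V] {ι : Type*} [Fintype ι]

open Classical in
/-- The number of members of a family that represent a given projective point. -/
noncomputable def pointMult (g : ι → V) (p : ℙ K V) : ℕ :=
  #{j | ∃ h : g j ≠ 0, Projectivization.mk K (g j) h = p}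

open Classical in
/-- Summation of a homogeneous function over a family, grouped by projective points. -/
lemma sum_eq_sum_pointMult [Fintype (ℙ K V)] {A : Type*} [AddCommMonoid A] (g : ι → V)
    (h : V → A) (h0 : h 0 = 0) (hh : ∀ (c : Kˣ) v, h (c • v) = h v) :
    ∑ j, h (g j) = ∑ p : ℙ K V, pointMult g p • h p.rep := by
  have key : ∀ j, h (g j) = ∑ p : ℙ K V,
      if ∃ h : g j ≠ 0, Projectivization.mk K (g j) h = p then h p.rep else 0 := by
    intro j
    by_cases hj : g j = 0
    · simp [hj, h0]
    · obtain ⟨a, ha⟩ := Projectivization.exists_smul_eq_mk_rep K (g j) hj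
      simp [hj, ← ha, hh]
  simp only [pointMult, card_filter, sum_smul]
  rw [sum_comm, sum_congr rfl fun j _ => key j]
  simp [ite_smul]

lemma pointMult_id [Fintype V] [Fintype K] (p : ℙ K V) :
    pointMult (fun v : V => v) p = Fintype.card K - 1 := by
  classical
  rw [pointMult, ← Fintype.card_units, ← card_univ]
  symm
  refine card_nbij (fun a : Kˣ => a • p.rep) (fun a _ => ?_) (fun a _ b _ hab => ?_) fun v hv => ?_
  · simp only [mem_coe, mem_filter_univ]
    refine ⟨by simpa [smul_eq_zero_iff_eq] using p.rep_nonzero, ?_⟩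
    conv_rhs => rw [← p.mk_rep]
    exact (Projectivization.mk_eq_mk_iff K _ _ _ _).mpr ⟨a, rfl⟩
  · exact Units.ext (smul_left_injective K p.rep_nonzero hab)
  · simp only [coe_filter, mem_univ, true_and, Set.mem_ofPred_eq] at hv
    obtain ⟨hv0, rfl⟩ := hv
    obtain ⟨a, ha⟩ := Projectivization.exists_smul_eq_mk_rep K v hv0
    exact ⟨a⁻¹, by simp, by simp [← ha]⟩

lemma sum_eq_card_sub_one_smul_sum [Fintype V] [Fintype K] [Fintype (ℙ K V)] {A : Type*}
    [AddCommMonoid A] (h : V → A) (h0 : h 0 = 0) (hh : ∀ (c : Kˣ) v, h (c • v) = h v) :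
    ∑ v, h v = (Fintype.card K - 1) • ∑ p : ℙ K V, h p.rep := by
  rw [sum_eq_sum_pointMult (fun v : V => v) h h0 hh, smul_sum]
  simp only [pointMult_id]

end ProjectiveSums

section PointCounts

variable {K : Type*} [Field K] [Fintype K] [DecidableEq K] {k : ℕ}
  [Fintype (ℙ K (Fin k → K))]

omit [Fintype K] [DecidableEq K] [Fintype (ℙ K (Fin k → K))] in
lemma smul_dotProduct_ne_zero_iff (c : Kˣ) (v b : Fin k → K) :
    (c • v) ⬝ᵥ b ≠ 0 ↔ v ⬝ᵥ b ≠ 0 := by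
  simp [Units.smul_def, smul_dotProduct]

omit [Fintype K] in
lemma card_not_orthogonal_eq_sum {ι : Type*} [Fintype ι] (g : ι → Fin k → K) (b : Fin k → K) :
    (#{j | g j ⬝ᵥ b ≠ 0} : ℤ) =
      ∑ p : ℙ K (Fin k → K), (pointMult g p : ℤ) * if p.rep ⬝ᵥ b ≠ 0 then 1 else 0 := by
  have h := sum_eq_sum_pointMult (K := K) g (fun v => if v ⬝ᵥ b ≠ 0 then (1 : ℤ) else 0) (by simp)
    fun c v => by simp only [smul_dotProduct_ne_zero_iff]
  simpa [card_filter] using h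

omit [DecidableEq K] in
lemma card_sub_one_mul_card_points (P : (Fin k → K) → Prop) [DecidablePred P] (h0 : ¬ P 0)
    (hP : ∀ (c : Kˣ) v, P (c • v) ↔ P v) :
    ((Fintype.card K : ℤ) - 1) * #{p : ℙ K (Fin k → K) | P p.rep} =
      #{v : Fin k → K | P v} := by
  have h := sum_eq_card_sub_one_smul_sum (K := K) (fun v => if P v then (1 : ℤ) else 0)
    (by simp [h0]) fun c v => by simp only [hP]
  have := Fintype.card_pos (α := K)
  simp only [card_filter, Nat.cast_sum, Nat.cast_ite, Nat.cast_one, Nat.cast_zero, h, nsmul_eq_mul,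
    Nat.cast_sub this]

omit [DecidableEq K] in
lemma card_sub_one_mul_card_projectivization :
    ((Fintype.card K : ℤ) - 1) * Fintype.card (ℙ K (Fin k → K)) = Fintype.card K ^ k - 1 := by
  have h := Projectivization.card' K (Fin k → K)
  have := Fintype.card_pos (α := K)
  simp only [Nat.card_eq_fintype_card, Fintype.card_fun, Fintype.card_fin] at h
  zify [this] at h
  linear_combination -h

/-- The number of points off a hyperplane. -/
lemma card_mul_card_points_off {b : Fin k → K} (hb : b ≠ 0) :
    (Fintype.card K : ℤ) * #{p : ℙ K (Fin k → K) | p.rep ⬝ᵥ b ≠ 0} = Fintype.card K ^ k := by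
  have h := card_sub_one_mul_card_points (fun v : Fin k → K => v ⬝ᵥ b ≠ 0) (by simp)
    fun c v => smul_dotProduct_ne_zero_iff c v b
  have h' := card_mul_card_not_orthogonal hb
  have hq : (Fintype.card K : ℤ) - 1 ≠ 0 := by
    have := Fintype.one_lt_card (α := K); omega
  apply mul_left_cancel₀ hq
  linear_combination (Fintype.card K : ℤ) * h + h'

/-- The number of points off two distinct hyperplanes. -/
lemma card_mul_card_points_off_pair {a b : Fin k → K} (ha : a ≠ 0) (hab : ∀ c : K, b ≠ c • a) :
    (Fintype.card K : ℤ) * #{p : ℙ K (Fin k → K) | p.rep ⬝ᵥ a ≠ 0 ∧ p.rep ⬝ᵥ b ≠ 0} =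
      (Fintype.card K - 1) * #{p : ℙ K (Fin k → K) | p.rep ⬝ᵥ a ≠ 0} := by
  have h₁ := card_sub_one_mul_card_points (fun v : Fin k → K => v ⬝ᵥ a ≠ 0) (by simp)
    fun c v => smul_dotProduct_ne_zero_iff c v a
  have h₂ := card_sub_one_mul_card_points (fun v : Fin k → K => v ⬝ᵥ a ≠ 0 ∧ v ⬝ᵥ b ≠ 0) (by simp)
    fun c v => and_congr (smul_dotProduct_ne_zero_iff c v a) (smul_dotProduct_ne_zero_iff c v b)
  have h' := card_mul_card_not_orthogonal_pair ha hab
  have hq : (Fintype.card K : ℤ) - 1 ≠ 0 := by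
    have := Fintype.one_lt_card (α := K); omega
  apply mul_left_cancel₀ hq
  linear_combination (Fintype.card K : ℤ) * h₂ - (Fintype.card K - 1 : ℤ) * h₁ + h'

omit [DecidableEq K] in
/-- The simplex code is self-orthogonal when `2 < (q - 1) k` and all units square to one. -/
lemma sum_points_dotProduct_mul_dotProduct (hk : 2 < (Fintype.card K - 1) * k)
    (hsq : ∀ c : Kˣ, c * c = 1) (x y : Fin k → K) :
    ∑ p : ℙ K (Fin k → K), (p.rep ⬝ᵥ x) * (p.rep ⬝ᵥ y) = 0 := by
  have h := sum_eq_card_sub_one_smul_sum (K := K) (fun v => (v ⬝ᵥ x) * (v ⬝ᵥ y)) (by simp)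
    fun c v => by
      simp only [Units.smul_def, smul_dotProduct, smul_eq_mul]
      have : (c : K) * c = 1 := by simpa using congrArg Units.val (hsq c)
      linear_combination (v ⬝ᵥ x) * (v ⬝ᵥ y) * this
  rw [sum_dotProduct_mul_dotProduct_eq_zero hk, nsmul_eq_mul,
    Nat.cast_sub Fintype.card_pos] at h
  simpa using h.symm

omit [Fintype (ℙ K (Fin k → K))] in
/-- In a code of minimum weight at least `d`, every projective point is represented by many
coordinates. -/
lemma le_pointMult {ι : Type*} [Fintype ι] (g : ι → Fin k → K) {d : ℕ}
    (hd : ∀ u : Fin k → K, u ≠ 0 → d ≤ #{j | g j ⬝ᵥ u ≠ 0}) (p : ℙ K (Fin k → K)) :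
    (Fintype.card K : ℤ) * d - (Fintype.card K - 1) * #{j | g j ≠ 0} ≤ pointMult g p := by
  classical
  set Q : ℤ := (Fintype.card K : ℤ) with hQ
  set B : ℤ := (#{u : Fin k → K | u ⬝ᵥ p.rep ≠ 0} : ℤ) with hB
  have hBpos : 0 < B := by
    have h := card_mul_card_not_orthogonal p.rep_nonzero
    have hq := Fintype.one_lt_card (α := K)
    have : (0 : ℤ) < (Fintype.card K - 1) * Fintype.card K ^ k := by
      apply mul_pos (by omega); positivity
    rw [← h] at this
    exact pos_of_mul_pos_right this (by positivity)
  have hlow : d * B ≤ ∑ u : Fin k → K with u ⬝ᵥ p.rep ≠ 0, (#{j | g j ⬝ᵥ u ≠ 0} : ℤ) := by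
    rw [mul_comm, hB, ← nsmul_eq_mul]
    refine card_nsmul_le_sum _ _ _ fun u hu => ?_
    exact_mod_cast hd u (by rintro rfl; simp at hu)
  have hswap : ∑ u : Fin k → K with u ⬝ᵥ p.rep ≠ 0, (#{j | g j ⬝ᵥ u ≠ 0} : ℤ) =
      ∑ j, (#{u : Fin k → K | u ⬝ᵥ p.rep ≠ 0 ∧ u ⬝ᵥ g j ≠ 0} : ℤ) := by
    simp only [card_filter, Nat.cast_sum, sum_filter, ite_and]
    rw [sum_comm]
    refine sum_congr rfl fun u _ => ?_
    by_cases h : u ⬝ᵥ p.rep = 0 <;> simp [h, dotProduct_comm]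
  have hterm : ∀ j, Q * (#{u : Fin k → K | u ⬝ᵥ p.rep ≠ 0 ∧ u ⬝ᵥ g j ≠ 0} : ℤ) =
      B * ((Q - 1) * (if g j ≠ 0 then 1 else 0) +
        if ∃ h : g j ≠ 0, Projectivization.mk K (g j) h = p then 1 else 0) := by
    intro j
    by_cases hj : g j = 0
    · simp [hj]
    by_cases hp : Projectivization.mk K (g j) hj = p
    · obtain ⟨a, ha⟩ := Projectivization.exists_smul_eq_mk_rep K (g j) hj
      rw [hp] at ha
      have hiff : ∀ u : Fin k → K, u ⬝ᵥ p.rep ≠ 0 ↔ u ⬝ᵥ g j ≠ 0 := fun u => by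
        rw [← ha, dotProduct_comm, smul_dotProduct_ne_zero_iff, dotProduct_comm]
      simp only [← hiff, and_self, ← hB, ne_eq, hj, not_false_eq_true, hp, exists_const, if_true]
      ring
    · have hab : ∀ c : K, g j ≠ c • p.rep := fun c hc => hp <| by
        conv_rhs => rw [← p.mk_rep]
        exact (Projectivization.mk_eq_mk_iff' K _ _ _ _).mpr ⟨c, hc.symm⟩
      rw [hQ, card_mul_card_not_orthogonal_pair p.rep_nonzero hab]
      simp [hj, hp, ← hB, mul_comm]
  have htot : Q * ∑ j, (#{u : Fin k → K | u ⬝ᵥ p.rep ≠ 0 ∧ u ⬝ᵥ g j ≠ 0} : ℤ) =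
      B * ((Q - 1) * #{j | g j ≠ 0} + pointMult g p) := by
    rw [mul_sum, sum_congr rfl fun j _ => hterm j, ← mul_sum, sum_add_distrib, ← mul_sum]
    rw [pointMult, natCast_card_filter, natCast_card_filter]
    congr!
  have hmain : B * (Q * d) ≤ B * ((Q - 1) * #{j | g j ≠ 0} + pointMult g p) := by
    rw [← htot, ← hswap]
    have := mul_le_mul_of_nonneg_left hlow (show 0 ≤ Q by positivity)
    linarith
  linarith [le_of_mul_le_mul_left hmain hBpos]

end PointCounts

section Shift

variable {K : Type*} [Field K] {k : ℕ}

lemma exists_forall_ne_smul (hk : 2 ≤ k) {u : Fin k → K} (hu : u ≠ 0) :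
    ∃ w : Fin k → K, ∀ c : K, w ≠ c • u := by
  have : Nontrivial (Fin k) := Fin.nontrivial_iff_two_le.mpr hk
  obtain ⟨i, hi⟩ := Function.ne_iff.mp hu
  obtain ⟨j, hj⟩ := exists_ne i
  refine ⟨Pi.single j 1, fun c hc => ?_⟩
  have hci := congrFun hc i
  rw [Pi.single_eq_of_ne hj.symm, Pi.smul_apply, smul_eq_mul] at hci
  have hcj := congrFun hc j
  simp [(mul_eq_zero.mp hci.symm).resolve_right hi] at hcj

/-- Prescribed multiplicities of projective points are realized by a family of vectors. -/
lemma exists_family_of_multiplicities [Fintype (ℙ K (Fin k → K))] {N : ℕ}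
    (m : ℙ K (Fin k → K) → ℕ) (hm : ∑ p, m p = N) :
    ∃ g : Fin N → Fin k → K, (∀ i, g i ≠ 0) ∧
      ∀ {A : Type} [AddCommMonoid A] (h : (Fin k → K) → A),
        ∑ i, h (g i) = ∑ p, m p • h p.rep := by
  let e : Fin N ≃ Σ p : ℙ K (Fin k → K), Fin (m p) :=
    (finCongr (by simp [hm])).trans (Fintype.equivFin _).symm
  refine ⟨fun i => (e i).1.rep, fun i => (e i).1.rep_nonzero, fun h => ?_⟩
  rw [e.sum_comp fun x => h x.1.rep, Fintype.sum_sigma]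
  simp

end Shift

section Construction

variable {K : Type} [Field K] [Fintype K] [DecidableEq K] {k : ℕ}

/-- Removing copies of the simplex code from a code of large minimum weight, and trading its zero
coordinates for points off a hyperplane, gives a code without zero coordinates whose columns
induce the same bilinear form. -/
lemma exists_shifted_family {n d r : ℕ} [Fintype (ℙ K (Fin k → K))] (hk : 2 ≤ k)
    (hqk : 2 < (Fintype.card K - 1) * k) (hsq : ∀ c : Kˣ, c * c = 1) (g : Fin n → Fin k → K)
    (hd : ∀ u : Fin k → K, u ≠ 0 → d ≤ #{j | g j ⬝ᵥ u ≠ 0})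
    {u₀ : Fin k → K} (hu₀ : u₀ ≠ 0) (hdu₀ : #{j | g j ⬝ᵥ u₀ ≠ 0} = d)
    (hr : (r : ℤ) = (Fintype.card K : ℤ) ^ (k - 1) * n - Fintype.card (ℙ K (Fin k → K)) * d) :
    ∃ g' : Fin (Fintype.card K * r) → Fin k → K, (∀ i, g' i ≠ 0) ∧
      (∀ u : Fin k → K, u ≠ 0 → (Fintype.card K - 1) * r ≤ #{i | g' i ⬝ᵥ u ≠ 0}) ∧
      #{i | g' i ⬝ᵥ u₀ ≠ 0} = (Fintype.card K - 1) * r ∧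
      ∀ x y : Fin k → K,
        ∑ i, (g' i ⬝ᵥ x) * (g' i ⬝ᵥ y) = ∑ j, (g j ⬝ᵥ x) * (g j ⬝ᵥ y) := by
  obtain ⟨w, hw⟩ := exists_forall_ne_smul hk hu₀
  have hw0 : w ≠ 0 := fun h => hw 0 (by simp [h])
  have hu₀w : ∀ c : K, u₀ ≠ c • w := fun c hc => by
    have hc0 : c ≠ 0 := by rintro rfl; exact hu₀ (by simpa using hc)
    exact hw c⁻¹ (by rw [hc, inv_smul_smul₀ hc0])
  have hq1 : 1 < Fintype.card K := Fintype.one_lt_card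
  have hQ0 : (Fintype.card K : ℤ) ≠ 0 := by omega
  obtain ⟨Q, hQ⟩ : ∃ Q : ℤ, Q = Fintype.card K := ⟨_, rfl⟩
  obtain ⟨z, hz⟩ : ∃ z : ℤ, z = n - #{j | g j ≠ 0} := ⟨_, rfl⟩
  have hz0 : 0 ≤ z := by
    have := card_filter_le (univ : Finset (Fin n)) (fun j => g j ≠ 0)
    rw [card_fin] at this
    omega
  obtain ⟨T, hT⟩ : ∃ T : ℤ, T = Q * d - (Q - 1) * (n - z) := ⟨_, rfl⟩
  have hle : ∀ p, T ≤ pointMult g p := fun p => by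
    have := le_pointMult g hd p
    rw [hT, hz, hQ]
    linarith
  have hind : ∀ p : ℙ K (Fin k → K), (0 : ℤ) ≤ if p.rep ⬝ᵥ w ≠ 0 then 1 else 0 := fun p => by
    split_ifs <;> simp
  have hnonneg : ∀ p : ℙ K (Fin k → K),
      0 ≤ pointMult g p - T + Q * z * if p.rep ⬝ᵥ w ≠ 0 then 1 else 0 := fun p => by
    have := mul_nonneg (mul_nonneg (by omega : 0 ≤ Q) hz0) (hind p)
    linarith [hle p]
  have hex : ∀ p, ∃ a : ℕ,
      (a : ℤ) = pointMult g p - T + Q * z * if p.rep ⬝ᵥ w ≠ 0 then 1 else 0 := fun p =>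
    ⟨_, Int.toNat_of_nonneg (hnonneg p)⟩
  choose m hm using hex
  have hpts : (Q - 1) * Fintype.card (ℙ K (Fin k → K)) = Q ^ k - 1 :=
    hQ ▸ card_sub_one_mul_card_projectivization
  have hpow : Q ^ k = Q * Q ^ (k - 1) := by
    rw [← pow_succ', Nat.sub_add_cancel (by omega)]
  rw [hpow] at hpts
  have hoff : ∀ {u : Fin k → K}, u ≠ 0 →
      (#{p : ℙ K (Fin k → K) | p.rep ⬝ᵥ u ≠ 0} : ℤ) = Q ^ (k - 1) := fun hu => by
    apply mul_left_cancel₀ hQ0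
    rw [card_mul_card_points_off hu, ← hQ, hpow]
  have hmult : ∑ p : ℙ K (Fin k → K), (pointMult g p : ℤ) = n - z := by
    have h := sum_eq_sum_pointMult (K := K) g (fun v => if v ≠ 0 then (1 : ℤ) else 0) (by simp)
      fun c v => by simp [smul_eq_zero_iff_eq]
    rw [hz]
    simpa [card_filter, Projectivization.rep_nonzero] using h.symm
  have hcount : ∀ u : Fin k → K, (#{p : ℙ K (Fin k → K) | p.rep ⬝ᵥ u ≠ 0} : ℤ) =
      ∑ p : ℙ K (Fin k → K), if p.rep ⬝ᵥ u ≠ 0 then 1 else 0 := fun u => by simp [card_filter]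
  have hlen : ∑ p, m p = Fintype.card K * r := by
    zify
    simp only [hm, sum_add_distrib, sum_sub_distrib, hmult, ← mul_sum, ← hcount, hoff hw0,
      sum_const, card_univ, nsmul_eq_mul, hr, ← hQ]
    rw [hT]
    linear_combination (n - z : ℤ) * hpts
  obtain ⟨g', hg'0, hg'⟩ := exists_family_of_multiplicities m hlen
  have hwt : ∀ u : Fin k → K, (#{i | g' i ⬝ᵥ u ≠ 0} : ℤ) = #{j | g j ⬝ᵥ u ≠ 0} -
      T * #{p : ℙ K (Fin k → K) | p.rep ⬝ᵥ u ≠ 0} +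
      z * (Q * #{p : ℙ K (Fin k → K) | p.rep ⬝ᵥ w ≠ 0 ∧ p.rep ⬝ᵥ u ≠ 0}) := by
    intro u
    have h := hg' fun v => if v ⬝ᵥ u ≠ 0 then (1 : ℤ) else 0
    rw [card_not_orthogonal_eq_sum g u]
    simp only [card_filter, Nat.cast_sum, Nat.cast_ite, Nat.cast_one, Nat.cast_zero, h,
      nsmul_eq_mul, hm, mul_sum, ← sum_sub_distrib, ← sum_add_distrib]
    refine sum_congr rfl fun p _ => ?_
    simp only [ite_and]
    split_ifs <;> ring
  have hqr : (((Fintype.card K - 1) * r : ℕ) : ℤ) = d - (T - (Q - 1) * z) * Q ^ (k - 1) := by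
    rw [Nat.cast_mul, Nat.cast_sub hq1.le, hr, ← hQ, hT]
    push_cast
    linear_combination (-d : ℤ) * hpts
  have hindep : ∀ u : Fin k → K, u ≠ 0 → (∀ c : K, u ≠ c • w) →
      (#{i | g' i ⬝ᵥ u ≠ 0} : ℤ) = #{j | g j ⬝ᵥ u ≠ 0} - (T - (Q - 1) * z) * Q ^ (k - 1) := by
    intro u hu huw
    rw [hwt, hQ, card_mul_card_points_off_pair hw0 huw, hoff hu, hoff hw0, hQ]
    ring
  refine ⟨g', hg'0, fun u hu => ?_, ?_, fun x y => ?_⟩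
  · have hdu : (d : ℤ) ≤ #{j | g j ⬝ᵥ u ≠ 0} := by exact_mod_cast hd u hu
    rw [← Nat.cast_le (α := ℤ), hqr]
    by_cases huw : ∀ c : K, u ≠ c • w
    · rw [hindep u hu huw]
      linarith
    · push Not at huw
      obtain ⟨c, rfl⟩ := huw
      have hc0 : c ≠ 0 := by rintro rfl; simp at hu
      have hsame : #{p : ℙ K (Fin k → K) | p.rep ⬝ᵥ w ≠ 0 ∧ p.rep ⬝ᵥ (c • w) ≠ 0} =
          #{p : ℙ K (Fin k → K) | p.rep ⬝ᵥ w ≠ 0} := by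
        simp [hc0]
      rw [hwt, hsame, hoff hu, hoff hw0]
      have : 0 ≤ z * Q ^ (k - 1) := mul_nonneg hz0 (pow_nonneg (by omega) _)
      linarith
  · rw [← Nat.cast_inj (R := ℤ), hindep u₀ hu₀ hu₀w, hdu₀, hqr]
  · rw [hg' fun v => (v ⬝ᵥ x) * (v ⬝ᵥ y),
      sum_eq_sum_pointMult (K := K) g (fun v => (v ⬝ᵥ x) * (v ⬝ᵥ y)) (by simp) fun c v => by
        simp only [Units.smul_def, smul_dotProduct, smul_eq_mul]
        have : (c : K) * c = 1 := by simpa using congrArg Units.val (hsq c)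
        linear_combination (v ⬝ᵥ x) * (v ⬝ᵥ y) * this]
    have hmK : ∀ p, (m p : K) = pointMult g p - T := fun p => by
      have h := congrArg (Int.cast : ℤ → K) (hm p)
      have hQK : (Q : K) = 0 := by rw [hQ]; simp
      push_cast [hQK] at h
      simpa using h
    simp only [nsmul_eq_mul, hmK, sub_mul, sum_sub_distrib]
    rw [← mul_sum, sum_points_dotProduct_mul_dotProduct hqk hsq, mul_zero, sub_zero]

end Construction

section Codes

variable {K : Type} [Field K] {k : ℕ}

/-- A code whose columns induce a nondegenerate bilinear form is LCD of full dimension. -/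
lemma injective_and_isLCD_of_nondegenerate {N : ℕ} (M : Matrix (Fin N) (Fin k) K)
    (h : ∀ x, (∀ y, (M *ᵥ x) ⬝ᵥ (M *ᵥ y) = 0) → x = 0) :
    Function.Injective M.mulVecLin ∧ IsLCD (LinearMap.range M.mulVecLin) := by
  constructor
  · refine (injective_iff_map_eq_zero _).mpr fun x hx => h x fun y => ?_
    rw [← mulVecLin_apply, hx, zero_dotProduct]
  · refine (Submodule.eq_bot_iff _).mpr ?_
    rintro _ ⟨⟨x, rfl⟩, hx⟩
    rw [h x fun y => hx _ ⟨y, rfl⟩, map_zero]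

lemma eq_zero_of_isLCD_range {N : ℕ} (M : Matrix (Fin N) (Fin k) K)
    (hinj : Function.Injective M.mulVecLin) (hM : IsLCD (LinearMap.range M.mulVecLin))
    {x : Fin k → K} (hx : ∀ y, (M *ᵥ x) ⬝ᵥ (M *ᵥ y) = 0) : x = 0 := by
  refine (injective_iff_map_eq_zero _).mp hinj x ((Submodule.eq_bot_iff _).mp hM _ ⟨⟨x, rfl⟩, ?_⟩)
  rintro _ ⟨y, rfl⟩
  exact hx y

/-- A code without zero coordinates has dual distance at least two. -/
lemma dualDistGe_two_range [DecidableEq K] {N : ℕ} (M : Matrix (Fin N) (Fin k) K)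
    (hM : ∀ i, M i ≠ 0) : DualDistGe (LinearMap.range M.mulVecLin) 2 := by
  intro x hx hx0
  by_contra! hlt
  obtain ⟨i, hi⟩ := Function.ne_iff.mp hx0
  have hzero : ∀ j, j ≠ i → x j = 0 := fun j hj => by
    by_contra hxj
    exact hj (card_le_one.mp (Nat.lt_succ_iff.mp hlt) j (by simpa using hxj) i (by simpa using hi))
  apply hM i
  refine dotProduct_eq_zero _ fun u => ?_
  have h := hx _ ⟨u, rfl⟩
  rw [sum_eq_single i (fun j _ hj => by rw [hzero j hj, zero_mul]) (by simp)] at h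
  exact (mul_eq_zero.mp h).resolve_left hi

lemma exists_matrix_range_eq {n : ℕ} (C : Submodule K (Fin n → K)) (hC : Module.finrank K C = k) :
    ∃ M : Matrix (Fin n) (Fin k) K, Function.Injective M.mulVecLin ∧
      LinearMap.range M.mulVecLin = C := by
  let f : (Fin k → K) ≃ₗ[K] C := LinearEquiv.ofFinrankEq _ _ (by simp [hC])
  refine ⟨LinearMap.toMatrix' (C.subtype ∘ₗ f.toLinearMap), ?_⟩
  rw [← Matrix.toLin'_apply', Matrix.toLin'_toMatrix']
  exact ⟨C.injective_subtype.comp f.injective, by simp [LinearMap.range_comp]⟩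

end Codes

lemma card_projectivization_zmod (q k : ℕ) [Fact q.Prime] [Fintype (ℙ (ZMod q) (Fin k → ZMod q))] :
    Fintype.card (ℙ (ZMod q) (Fin k → ZMod q)) = qrep q k := by
  rw [← Nat.card_eq_fintype_card, Projectivization.card_of_finrank (ZMod q) _ (n := k) (by simp)]
  simp [qrep]

/-- Over a prime field whose units square to one, an LCD `[n,k,d]` code gives rise to an LCD
`[q·r, k, (q−1)·r]` code with dual distance at least two. -/
lemma exists_lcd_of_lcd {q k n d r : ℕ} [Fact q.Prime] (hk : 2 ≤ k) (hqk : 2 < (q - 1) * k)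
    (hsq : ∀ c : (ZMod q)ˣ, c * c = 1)
    (hr : (r : ℤ) = (q : ℤ) ^ (k - 1) * n - (qrep q k : ℤ) * d)
    {C : Submodule (ZMod q) (Fin n → ZMod q)} (hC : Module.finrank (ZMod q) C = k)
    (hLCD : IsLCD C) (hd : HasMinWeight C d) :
    ∃ C₀ : Submodule (ZMod q) (Fin (q * r) → ZMod q),
      Module.finrank (ZMod q) C₀ = k ∧ IsLCD C₀ ∧ HasMinWeight C₀ ((q - 1) * r) ∧
      DualDistGe C₀ 2 := by
  have := Fintype.ofFinite (ℙ (ZMod q) (Fin k → ZMod q))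
  obtain ⟨M, hinj, rfl⟩ := exists_matrix_range_eq C hC
  obtain ⟨⟨_, ⟨u₀, rfl⟩, hu₀, hdu₀⟩, hmin⟩ := hd
  have hq := ZMod.card q
  rw [← card_projectivization_zmod] at hr
  have hu₀' : u₀ ≠ 0 := fun h => hu₀ (by rw [h, map_zero])
  have hshift := exists_shifted_family hk (by rwa [hq]) hsq M
    (fun u hu => hmin _ ⟨u, rfl⟩ ((map_ne_zero_iff _ hinj).mpr hu)) hu₀' hdu₀ (by rwa [hq])
  rw [hq] at hshift
  obtain ⟨M', hM'0, hM'min, hM'u₀, hgram⟩ := hshift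
  obtain ⟨hinj', hLCD'⟩ := injective_and_isLCD_of_nondegenerate (of M') fun x hx =>
    eq_zero_of_isLCD_range M hinj hLCD fun y => (hgram x y).symm.trans (hx y)
  refine ⟨_, ?_, hLCD', ⟨⟨_, ⟨u₀, rfl⟩, (map_ne_zero_iff _ hinj').mpr hu₀', hM'u₀⟩, ?_⟩,
    dualDistGe_two_range (of M') hM'0⟩
  · rw [LinearMap.finrank_range_of_inj hinj', Module.finrank_fin_fun]
  · rintro _ ⟨u, rfl⟩ hu
    exact hM'min u fun h => hu (by rw [h, map_zero])

/-- If there is no LCD `[q·r, k, (q−1)·r]` code over `𝔽_q` with dual distance `≥ 2`,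
then there is no LCD `[n,k,d]` code over `𝔽_q`, where `r = r_{q,n,k,d}`. -/
theorem no_lcd_of_no_small {q k₀ k n d r : ℕ}
    (hq : (q = 2 ∧ k₀ = 3) ∨ (q = 3 ∧ k₀ = 2)) (hk : k₀ ≤ k)
    (hd : 1 ≤ (q : ℤ) * d - ((q : ℤ) - 1) * n)
    (hr : (r : ℤ) = (q : ℤ) ^ (k - 1) * n - (qrep q k : ℤ) * d)
    (hqr : k ≤ q * r)
    (h : ¬ ∃ C₀ : Submodule (ZMod q) (Fin (q * r) → ZMod q),
      Module.finrank (ZMod q) C₀ = k ∧ IsLCD C₀ ∧ HasMinWeight C₀ ((q - 1) * r) ∧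
      DualDistGe C₀ 2) :
    ¬ ∃ C : Submodule (ZMod q) (Fin n → ZMod q),
      Module.finrank (ZMod q) C = k ∧ IsLCD C ∧ HasMinWeight C d := by
  rintro ⟨C, hC, hLCD, hmin⟩
  apply h
  obtain ⟨rfl, rfl⟩ | ⟨rfl, rfl⟩ := hq
  · exact exists_lcd_of_lcd (by omega) (by omega) (by decide) hr hC hLCD hmin
  · exact exists_lcd_of_lcd hk (by omega) (by decide) hr hC hLCD hmin
end

section
/- Suppose (q,k₀) ∈ {(2,3),(3,2)} and k ≥ k₀. Fix t ∈ {0,1,…,[k]_q − 1} and an integer α, and for s ∈ ℤ_{≥0} set d(s) = q^{k−1}·s + α, n(s) = [k]_q·s + t. Let r = q^{k−1}·t − [k]_q·α and s′ = (q·r − t)/[k]_q + 1, and suppose q·r ≥ k. Then for every integer s ≥ s′ with n(s) ≥ k, there is a bijection between the set of equivalence classes of LCD [q·r, k, (q−1)·r] codes over 𝔽_q with dual distance d⊥ ≥ 2 (note q·r = [k]_q·(s′−1) + t and (q−1)·r = q^{k−1}·(s′−1) + α) and the set of equivalence classes of LCD [[k]_q·s + t, k, q^{k−1}·s + α] codes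 over 𝔽_q with dual distance d⊥ ≥ 2. -/
open Matrix Finset

namespace LCDCode

open scoped LinearAlgebra.Projectivization

section Counting

variable {F : Type*} [Field F] [Fintype F] {k : ℕ}

noncomputable instance : Fintype (ℙ F (Fin k → F)) := Fintype.ofFinite _

noncomputable instance : DecidableEq (ℙ F (Fin k → F)) := Classical.decEq _

/-- The number of indices at which a family of points takes the value `p`. -/
noncomputable def multiplicity {ι : Type*} [Fintype ι] (P : ι → ℙ F (Fin k → F))
    (p : ℙ F (Fin k → F)) : ℕ := #{i | P i = p}

lemma sum_comp_eq_sum_multiplicity {ι M : Type*} [Fintype ι] [AddCommMonoid M]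
    (P : ι → ℙ F (Fin k → F)) (f : ℙ F (Fin k → F) → M) :
    ∑ i, f (P i) = ∑ p, multiplicity P p • f p := by
  rw [← Finset.sum_fiberwise (g := P)]
  refine Finset.sum_congr rfl fun p _ => ?_
  rw [Finset.sum_congr rfl (g := fun _ => f p), Finset.sum_const, multiplicity]
  intro i hi
  rw [(Finset.mem_filter.1 hi).2]

lemma sum_multiplicity {ι : Type*} [Fintype ι] (P : ι → ℙ F (Fin k → F)) :
    ∑ p, multiplicity P p = Fintype.card ι := by
  have := sum_comp_eq_sum_multiplicity P (fun _ => 1)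
  simpa using this.symm

lemma exists_multiplicity_eq {n : ℕ} (μ : ℙ F (Fin k → F) → ℕ) (h : ∑ p, μ p = n) :
    ∃ P : Fin n → ℙ F (Fin k → F), multiplicity P = μ := by
  have e : Fin n ≃ Σ p, Fin (μ p) := Fintype.equivOfCardEq (by simp [h])
  refine ⟨fun i => (e i).1, ?_⟩
  funext p
  have e₂ : {i // (e i).1 = p} ≃ Fin (μ p) :=
    (e.subtypeEquiv (q := fun a => a.1 = p) fun _ => Iff.rfl).trans (Equiv.sigmaSubtype p)
  rw [multiplicity, ← Fintype.card_subtype, Fintype.card_congr e₂, Fintype.card_fin]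

lemma card_projectivization (q : ℕ) (hq : Fintype.card F = q) :
    Fintype.card (ℙ F (Fin k → F)) = qrep q k := by
  rw [← Nat.card_eq_fintype_card, Projectivization.card_of_finrank F (Fin k → F) (n := k) (by simp),
    Nat.card_eq_fintype_card, hq, qrep]

/-- The fibres of a surjective linear map over a finite field are equidistributed. -/
lemma card_preimage_mul {W : Type*} [AddCommGroup W] [Module F W] [Fintype W] [DecidableEq W]
    (f : (Fin k → F) →ₗ[F] W) (hf : Function.Surjective f) (S : Finset W) :
    #{x | f x ∈ S} * Fintype.card W = #S * Fintype.card F ^ k := by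
  have hfib : ∀ w, #{x | f x = w} = #{x | f x = 0} := fun w =>
    AddMonoidHom.card_fiber_eq_of_mem_range f (hf w) (hf 0)
  have hS : ∀ S : Finset W, #{x | f x ∈ S} = #S * #{x | f x = 0} := fun S => by
    rw [Finset.card_eq_sum_card_fiberwise (f := f) (t := S) (fun x hx => by simpa using hx),
      Finset.sum_congr rfl (g := fun _ => #{x | f x = 0}), Finset.sum_const, smul_eq_mul]
    intro w hw
    rw [← hfib w, Finset.filter_filter]
    congr 1
    ext x
    simp only [Finset.mem_filter, Finset.mem_univ, true_and]
    exact ⟨fun h => h.2, fun h => ⟨h ▸ hw, h⟩⟩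
  have hu := hS Finset.univ
  simp only [Finset.mem_univ, Finset.filter_true, Finset.card_univ, Fintype.card_pi,
    Finset.prod_const, Fintype.card_fin] at hu
  rw [hS, hu]
  ring

variable [DecidableEq F]

/-- A function invariant under nonzero scalars is summed over the nonzero vectors by summing it
over the projective points, `q - 1` times. -/
lemma sum_eq_smul_sum_rep {M : Type*} [AddCommMonoid M] (h : (Fin k → F) → M) (h0 : h 0 = 0)
    (hc : ∀ c : F, c ≠ 0 → ∀ v, h (c • v) = h v) :
    ∑ v, h v = (Fintype.card F - 1) • ∑ p : ℙ F (Fin k → F), h p.rep := by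
  have key : ∑ x : ℙ F (Fin k → F) × Fˣ, h (x.2 • x.1.rep) =
      ∑ v : {v : Fin k → F // v ≠ 0}, h v := by
    refine Fintype.sum_bijective
      (fun x : ℙ F (Fin k → F) × Fˣ => (⟨x.2 • x.1.rep,
        (smul_ne_zero_iff_ne x.2).2 x.1.rep_nonzero⟩ : {v : Fin k → F // v ≠ 0}))
      ⟨?_, ?_⟩ _ _ fun _ => rfl
    · rintro ⟨p, u⟩ ⟨p', u'⟩ h
      simp only [Subtype.mk.injEq] at h
      have hp : p = p' := by
        rw [← p.mk_rep, ← p'.mk_rep, Projectivization.mk_eq_mk_iff]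
        exact ⟨u⁻¹ * u', by rw [mul_smul, ← h, inv_smul_smul]⟩
      subst hp
      have : (u : F) = u' := smul_left_injective F p.rep_nonzero h
      rw [Units.ext this]
    · rintro ⟨v, hv⟩
      obtain ⟨a, ha⟩ := Projectivization.exists_smul_eq_mk_rep F v hv
      refine ⟨(Projectivization.mk F v hv, a⁻¹), ?_⟩
      simp [← ha]
  have h1 : ∑ v, h v = ∑ v : {v : Fin k → F // v ≠ 0}, h v := by
    rw [Fintype.sum_eq_add_sum_subtype_ne h 0, h0, zero_add]
  rw [h1, ← key, Fintype.sum_prod_type, Finset.smul_sum]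
  refine Finset.sum_congr rfl fun p _ => ?_
  rw [← Fintype.card_units, ← Finset.card_univ, ← Finset.sum_const]
  exact Finset.sum_congr rfl fun u _ => hc u u.ne_zero _

lemma card_dotProduct_ne_zero {v : Fin k → F} (hv : v ≠ 0) :
    #{x | v ⬝ᵥ x ≠ 0} * Fintype.card F = (Fintype.card F - 1) * Fintype.card F ^ k := by
  have hs : Function.Surjective (dotProductBilin F F v) := by
    refine LinearMap.surjective_of_ne_zero fun h => hv ?_
    exact dotProduct_eq_zero_iff.1 fun w => LinearMap.congr_fun h w
  have := card_preimage_mul _ hs ({0}ᶜ : Finset F)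
  simpa [Finset.card_compl] using this

lemma card_dotProduct_ne_zero_and {p p' : ℙ F (Fin k → F)} (h : p ≠ p') :
    #{x | p.rep ⬝ᵥ x ≠ 0 ∧ p'.rep ⬝ᵥ x ≠ 0} * Fintype.card F ^ 2 =
      (Fintype.card F - 1) ^ 2 * Fintype.card F ^ k := by
  have hli := Projectivization.linearIndependent_pair_iff_ne.2 h
  let M : Matrix (Fin 2) (Fin k) F := Matrix.of ![p.rep, p'.rep]
  have hs : Function.Surjective M.mulVecLin := by
    have := LinearIndependent.rank_matrix (M := M) hli
    rw [← LinearMap.range_eq_top]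
    apply Submodule.eq_top_of_finrank_eq
    rw [Matrix.rank] at this
    simpa using this
  have := card_preimage_mul _ hs (Fintype.piFinset fun _ => ({0}ᶜ : Finset F))
  simpa [Finset.card_compl, M, Matrix.mulVec, Fin.forall_fin_two] using this

lemma card_rep_dotProduct_ne_zero {x : Fin k → F} (hx : x ≠ 0) :
    #{p : ℙ F (Fin k → F) | p.rep ⬝ᵥ x ≠ 0} * Fintype.card F = Fintype.card F ^ k := by
  have h := sum_eq_smul_sum_rep (fun v => if v ⬝ᵥ x ≠ 0 then 1 else 0) (by simp)
    (fun c hc v => by simp [hc])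
  simp only [← Finset.card_filter, smul_eq_mul, dotProduct_comm _ x] at h
  have h2 := card_dotProduct_ne_zero hx
  rw [h, mul_assoc] at h2
  simp only [dotProduct_comm _ x]
  exact Nat.eq_of_mul_eq_mul_left (Nat.sub_pos_of_lt Fintype.one_lt_card) h2

/-- The rows of the simplex generator matrix are pairwise orthogonal and self-orthogonal. -/
lemma sum_rep_dotProduct_mul (hF : ∀ c : F, c ≠ 0 → c * c = 1)
    (hk : 2 < (Fintype.card F - 1) * k) (x y : Fin k → F) :
    ∑ p : ℙ F (Fin k → F), (p.rep ⬝ᵥ x) * (p.rep ⬝ᵥ y) = 0 := by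
  have h := sum_eq_smul_sum_rep (fun v : Fin k → F => (v ⬝ᵥ x) * (v ⬝ᵥ y)) (by simp)
    (fun c hc v => by
      simp only [smul_dotProduct, smul_eq_mul]
      linear_combination (v ⬝ᵥ x) * (v ⬝ᵥ y) * hF c hc)
  let L : (Fin k → F) → MvPolynomial (Fin k) F := fun x =>
    ∑ a, MvPolynomial.C (x a) * MvPolynomial.X a
  have hL : ∀ x, (L x).totalDegree ≤ 1 := fun x =>
    MvPolynomial.totalDegree_finsetSum_le fun a _ =>
      (MvPolynomial.totalDegree_mul _ _).trans (by simp)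
  have hz := MvPolynomial.sum_eval_eq_zero (L x * L y) (by
    have := MvPolynomial.totalDegree_mul (L x) (L y)
    have := hL x
    have := hL y
    rw [Fintype.card_fin]
    omega)
  have he : ∀ v x : Fin k → F, MvPolynomial.eval v (L x) = v ⬝ᵥ x := fun v x => by
    simp [L, dotProduct, mul_comm]
  simp only [map_mul, he] at hz
  rw [hz, nsmul_eq_mul, Nat.cast_pred Fintype.card_pos, FiniteField.cast_card_eq_zero] at h
  simpa using h.symm

end Counting

section Multiplicity

variable {F : Type*} [Field F] [Fintype F] [DecidableEq F] {k n : ℕ}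

/-- The weight of the codeword indexed by `x` in a code with column multiplicities `μ`. -/
noncomputable def multWt (μ : ℙ F (Fin k → F) → ℕ) (x : Fin k → F) : ℕ :=
  ∑ p, μ p * if p.rep ⬝ᵥ x ≠ 0 then 1 else 0

/-- The inner product of two codewords in a code with column multiplicities `μ`. -/
noncomputable def multGram (μ : ℙ F (Fin k → F) → ℕ) (x y : Fin k → F) : F :=
  ∑ p, μ p • ((p.rep ⬝ᵥ x) * (p.rep ⬝ᵥ y))

/-- Column multiplicities of an LCD code with minimum weight `d`. -/
def IsLCDMult (μ : ℙ F (Fin k → F) → ℕ) (d : ℕ) : Prop :=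
  (∀ x, (∀ y, multGram μ x y = 0) → x = 0) ∧
    (∃ x, x ≠ 0 ∧ multWt μ x = d) ∧ ∀ x, x ≠ 0 → d ≤ multWt μ x

lemma multWt_add_const (μ : ℙ F (Fin k → F) → ℕ) (m : ℕ) {x : Fin k → F} (hx : x ≠ 0)
    (hk : 0 < k) :
    multWt (fun p => μ p + m) x = multWt μ x + m * Fintype.card F ^ (k - 1) := by
  have h := card_rep_dotProduct_ne_zero hx
  obtain ⟨k, rfl⟩ := Nat.exists_eq_succ_of_ne_zero hk.ne'
  rw [pow_succ] at h
  have h2 := Nat.eq_of_mul_eq_mul_right Fintype.card_pos h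
  simp only [multWt, add_mul, Finset.sum_add_distrib, ← Finset.mul_sum, ← Finset.card_filter, h2,
    Nat.succ_sub_one]

lemma multGram_add_const (hF : ∀ c : F, c ≠ 0 → c * c = 1) (hk : 2 < (Fintype.card F - 1) * k)
    (μ : ℙ F (Fin k → F) → ℕ) (m : ℕ) (x y : Fin k → F) :
    multGram (fun p => μ p + m) x y = multGram μ x y := by
  simp only [multGram, add_smul, Finset.sum_add_distrib, ← Finset.smul_sum,
    sum_rep_dotProduct_mul hF hk, smul_zero, add_zero]

lemma isLCDMult_add_const_iff (hF : ∀ c : F, c ≠ 0 → c * c = 1)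
    (hk : 2 < (Fintype.card F - 1) * k) (μ : ℙ F (Fin k → F) → ℕ) (m d : ℕ) :
    IsLCDMult (fun p => μ p + m) (d + m * Fintype.card F ^ (k - 1)) ↔ IsLCDMult μ d := by
  have hk0 : 0 < k := Nat.pos_of_ne_zero (by rintro rfl; simp at hk)
  simp only [IsLCDMult, multGram_add_const hF hk]
  refine and_congr Iff.rfl (and_congr (exists_congr fun x => and_congr_right fun hx => ?_)
    (forall₂_congr fun x hx => ?_)) <;> rw [multWt_add_const _ _ hx hk0] <;> omega

/-- Averaging the weights over the hyperplanes missing a point bounds its multiplicity. -/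
lemma card_mul_le_multiplicity {μ : ℙ F (Fin k → F) → ℕ} {d : ℕ}
    (h : ∀ x, x ≠ 0 → d ≤ multWt μ x) (p : ℙ F (Fin k → F)) :
    Fintype.card F * d ≤ μ p + (Fintype.card F - 1) * ∑ p, μ p := by
  set q := Fintype.card F with hq
  have hq1 : 0 < q - 1 := Nat.sub_pos_of_lt Fintype.one_lt_card
  have hsum : #{x | p.rep ⬝ᵥ x ≠ 0} * d ≤
      ∑ p', μ p' * #{x | p.rep ⬝ᵥ x ≠ 0 ∧ p'.rep ⬝ᵥ x ≠ 0} := by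
    calc #{x | p.rep ⬝ᵥ x ≠ 0} * d
        ≤ ∑ x with p.rep ⬝ᵥ x ≠ 0, multWt μ x := by
          rw [← smul_eq_mul]
          refine Finset.card_nsmul_le_sum _ _ _ fun x hx => h x ?_
          rintro rfl
          simp at hx
      _ = _ := by
          simp only [multWt]
          rw [Finset.sum_comm]
          refine Finset.sum_congr rfl fun p' _ => ?_
          rw [← Finset.mul_sum, ← Finset.card_filter, Finset.filter_filter]
  have hp := card_dotProduct_ne_zero p.rep_nonzero
  have hterm : ∀ p', (μ p' * #{x | p.rep ⬝ᵥ x ≠ 0 ∧ p'.rep ⬝ᵥ x ≠ 0}) * q ^ 2 ≤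
      ((if p' = p then μ p else 0) + (q - 1) * μ p') * ((q - 1) * q ^ k) := by
    intro p'
    by_cases hpp : p' = p
    · subst hpp
      simp only [and_self, if_true]
      rw [pow_two, mul_assoc, ← mul_assoc _ q q, hp]
      have : μ p' + (q - 1) * μ p' = μ p' * q := by
        obtain ⟨r, hr⟩ : ∃ r, q = r + 1 := ⟨q - 1, by omega⟩
        rw [hr, Nat.add_sub_cancel]; ring
      rw [this]
      exact le_of_eq (by ring)
    · rw [if_neg hpp, zero_add, mul_assoc, card_dotProduct_ne_zero_and (Ne.symm hpp)]
      exact le_of_eq (by ring)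
  have h2 := Nat.mul_le_mul_right (q ^ 2) hsum
  rw [Finset.sum_mul] at h2
  have h3 := h2.trans (Finset.sum_le_sum fun p' _ => hterm p')
  rw [← Finset.sum_mul, Finset.sum_add_distrib, ← Finset.mul_sum, Finset.sum_ite_eq',
    if_pos (Finset.mem_univ _)] at h3
  have h4 : #{x | p.rep ⬝ᵥ x ≠ 0} * d * q ^ 2 = (q * d) * ((q - 1) * q ^ k) := by
    rw [← hp]; ring
  rw [h4] at h3
  exact Nat.le_of_mul_le_mul_right h3 (by positivity)

end Multiplicity

section Representation

variable {F : Type*} [Field F] {k n : ℕ}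

/-- `C` has an injective generator matrix, written with the columns as rows, whose columns are
nonzero multiples of representatives of the points `P`. -/
def Represents (C : Submodule F (Fin n → F)) (P : Fin n → ℙ F (Fin k → F)) : Prop :=
  ∃ G : Matrix (Fin n) (Fin k) F, Function.Injective G.mulVecLin ∧
    LinearMap.range G.mulVecLin = C ∧ ∀ i, ∃ c : F, c ≠ 0 ∧ G i = c • (P i).rep

lemma Represents.finrank_eq {C : Submodule F (Fin n → F)} {P : Fin n → ℙ F (Fin k → F)}
    (h : Represents C P) : Module.finrank F C = k := by
  obtain ⟨G, hinj, rfl, -⟩ := h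
  simpa using LinearMap.finrank_range_of_inj hinj

lemma sum_mulVec_mul_mulVec [Fintype F] (hF : ∀ c : F, c ≠ 0 → c * c = 1)
    {G : Matrix (Fin n) (Fin k) F} {P : Fin n → ℙ F (Fin k → F)} (hG : ∀ i, ∃ c : F, c ≠ 0 ∧ G i = c • (P i).rep)
    (x y : Fin k → F) :
    ∑ i, (G *ᵥ x) i * (G *ᵥ y) i = multGram (multiplicity P) x y := by
  rw [multGram, ← sum_comp_eq_sum_multiplicity P fun p => (p.rep ⬝ᵥ x) * (p.rep ⬝ᵥ y)]
  refine Finset.sum_congr rfl fun i _ => ?_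
  obtain ⟨c, hc, hi⟩ := hG i
  simp only [Matrix.mulVec, hi, smul_dotProduct, smul_eq_mul]
  linear_combination ((P i).rep ⬝ᵥ x) * ((P i).rep ⬝ᵥ y) * hF c hc

variable [DecidableEq F]

lemma exists_represents {C : Submodule F (Fin n → F)} (hC : Module.finrank F C = k)
    (hd : DualDistGe C 2) : ∃ P : Fin n → ℙ F (Fin k → F), Represents C P := by
  let e : (Fin k → F) ≃ₗ[F] C := LinearEquiv.ofFinrankEq _ _ (by simp [hC])
  let L : (Fin k → F) →ₗ[F] (Fin n → F) := C.subtype ∘ₗ e.toLinearMap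
  let G := LinearMap.toMatrix' L
  have hG : G.mulVecLin = L := Matrix.toLin'_toMatrix' L
  have hrange : LinearMap.range G.mulVecLin = C := by
    rw [hG, LinearMap.range_comp, LinearEquiv.range, Submodule.map_top, Submodule.range_subtype]
  have hne : ∀ i, G i ≠ 0 := by
    intro i hi
    have hmem : Pi.single i 1 ∈ dualCode C := by
      intro y hy
      rw [← hrange] at hy
      obtain ⟨x, rfl⟩ := hy
      simp [Pi.single_apply, Matrix.mulVec, hi]
    have h2 := hd _ hmem (by simp)
    have h1 : wt (Pi.single i (1 : F) : Fin n → F) = 1 := by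
      simp [wt, Pi.single_apply, Finset.filter_eq']
    omega
  refine ⟨fun i => Projectivization.mk F (G i) (hne i), G, ?_, hrange, fun i => ?_⟩
  · rw [hG]
    exact C.injective_subtype.comp e.injective
  · obtain ⟨a, ha⟩ := Projectivization.exists_smul_eq_mk_rep F (G i) (hne i)
    exact ⟨(a⁻¹ : Fˣ), Units.ne_zero _, by
      rw [← ha]
      exact (inv_smul_smul a (G i)).symm⟩

lemma Represents.dualDistGe {C : Submodule F (Fin n → F)} {P : Fin n → ℙ F (Fin k → F)}
    (h : Represents C P) : DualDistGe C 2 := by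
  obtain ⟨G, hinj, rfl, hG⟩ := h
  intro x hx hx0
  by_contra hlt
  obtain ⟨i, hi⟩ := Function.ne_iff.1 hx0
  have hwt : wt x ≤ 1 := by omega
  have hzero : ∀ j, j ≠ i → x j = 0 := by
    intro j hj
    by_contra hxj
    exact hj (Finset.card_le_one.1 hwt j (by simpa using hxj) i (by simpa using hi))
  obtain ⟨c, hc, hGi⟩ := hG i
  refine (P i).rep_nonzero (dotProduct_eq_zero_iff.1 fun y => ?_)
  have := hx _ ⟨y, rfl⟩
  rw [Finset.sum_eq_single i (fun j _ hj => by rw [hzero j hj, zero_mul]) (by simp)] at this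
  have h2 := (mul_eq_zero.1 this).resolve_left hi
  simp only [Matrix.mulVecLin_apply, Matrix.mulVec, hGi, smul_dotProduct, smul_eq_mul] at h2
  exact (mul_eq_zero.1 h2).resolve_left hc

variable [Fintype F]

lemma wt_mulVec {G : Matrix (Fin n) (Fin k) F} {P : Fin n → ℙ F (Fin k → F)}
    (hG : ∀ i, ∃ c : F, c ≠ 0 ∧ G i = c • (P i).rep) (x : Fin k → F) :
    wt (G *ᵥ x) = multWt (multiplicity P) x := by
  have h := sum_comp_eq_sum_multiplicity P fun p => if p.rep ⬝ᵥ x ≠ 0 then 1 else 0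
  rw [multWt]
  simp only [smul_eq_mul] at h
  rw [← h, wt, Finset.card_filter]
  refine Finset.sum_congr rfl fun i _ => ?_
  obtain ⟨c, hc, hi⟩ := hG i
  simp only [Matrix.mulVec, hi, smul_dotProduct, smul_eq_mul, ne_eq, mul_eq_zero, hc, false_or]

lemma Represents.isLCD_and_hasMinWeight_iff (hF : ∀ c : F, c ≠ 0 → c * c = 1)
    {C : Submodule F (Fin n → F)} {P : Fin n → ℙ F (Fin k → F)} (h : Represents C P) (d : ℕ) :
    IsLCD C ∧ HasMinWeight C d ↔ IsLCDMult (multiplicity P) d := by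
  obtain ⟨G, hinj, rfl, hG⟩ := h
  have hne : ∀ x, G *ᵥ x ≠ 0 ↔ x ≠ 0 := fun x =>
    (map_ne_zero_iff G.mulVecLin hinj)
  refine and_congr ?_ (and_congr ?_ ?_)
  · simp only [IsLCD, ← sum_mulVec_mul_mulVec hF hG]
    rw [Submodule.eq_bot_iff]
    constructor
    · intro hL x hx
      by_contra hx0
      refine (hne x).2 hx0 (hL _ ⟨⟨x, rfl⟩, ?_⟩)
      rintro _ ⟨y, rfl⟩
      exact hx y
    · rintro hL _ ⟨⟨x, rfl⟩, hx⟩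
      rw [hL x fun y => hx _ ⟨y, rfl⟩, map_zero]
  · simp only [LinearMap.mem_range, Matrix.mulVecLin_apply, ← wt_mulVec hG]
    constructor
    · rintro ⟨_, ⟨x, rfl⟩, hx, hw⟩
      exact ⟨x, (hne x).1 hx, hw⟩
    · rintro ⟨x, hx, hw⟩
      exact ⟨_, ⟨x, rfl⟩, (hne x).2 hx, hw⟩
  · simp only [← wt_mulVec hG]
    constructor
    · exact fun h x hx => h _ ⟨x, rfl⟩ ((hne x).2 hx)
    · rintro h _ ⟨x, rfl⟩ hx
      exact h x ((hne x).1 hx)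

lemma IsLCDMult.exists_represents {P : Fin n → ℙ F (Fin k → F)} {d : ℕ}
    (h : IsLCDMult (multiplicity P) d) : ∃ C, Represents C P := by
  refine ⟨_, Matrix.of fun i => (P i).rep, ?_, rfl, fun i => ⟨1, one_ne_zero, (one_smul F _).symm⟩⟩
  rw [← LinearMap.ker_eq_bot, LinearMap.ker_eq_bot']
  intro x hx
  refine h.1 x fun y => ?_
  rw [multGram, ← sum_comp_eq_sum_multiplicity P fun p => (p.rep ⬝ᵥ x) * (p.rep ⬝ᵥ y)]
  refine Finset.sum_eq_zero fun i _ => ?_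
  have : (P i).rep ⬝ᵥ x = 0 := congrFun hx i
  rw [this, zero_mul]

end Representation

section Equivalence

variable {F : Type*} [Field F] {k n : ℕ}

/-- Every automorphism of `F ^ k` has an adjoint for the dot product. -/
lemma exists_dotProduct_adjoint (B : (Fin k → F) ≃ₗ[F] (Fin k → F)) :
    ∃ A : (Fin k → F) ≃ₗ[F] (Fin k → F), ∀ v x, A v ⬝ᵥ x = v ⬝ᵥ B x := by
  have hBB : ∀ B : (Fin k → F) ≃ₗ[F] (Fin k → F),
      LinearMap.toMatrix' B.symm.toLinearMap * LinearMap.toMatrix' B.toLinearMap = 1 := fun B => by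
    rw [← LinearMap.toMatrix'_comp]
    simp
  refine ⟨LinearEquiv.ofLinearMap (LinearMap.toMatrix' B.toLinearMap).vecMulLinear
    (LinearMap.toMatrix' B.symm.toLinearMap).vecMulLinear ?_ ?_, fun v x => ?_⟩
  · refine LinearMap.ext fun v => ?_
    simp [hBB]
  · refine LinearMap.ext fun v => ?_
    simpa using congrArg (v ᵥ* ·) (hBB B.symm)
  · rw [LinearEquiv.coe_ofLinearMap, Matrix.vecMulLinear_apply,
      ← Matrix.dotProduct_mulVec, LinearMap.toMatrix'_mulVec]
    rfl

/-- The entries of a vector multiplied by a monomial matrix. -/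
lemma vecMul_monomial {M : Matrix (Fin n) (Fin n) F} {σ : Equiv.Perm (Fin n)} {c : Fin n → F}
    (hM : ∀ i j, M i j = if σ i = j then c i else 0) (z : Fin n → F) (i : Fin n) :
    (z ᵥ* M) (σ i) = z i * c i := by
  simp [Matrix.vecMul, dotProduct, hM]

lemma codeEquiv_refl (C : Submodule F (Fin n → F)) : codeEquiv C C := by
  refine ⟨1, ⟨1, 1, fun _ => one_ne_zero, fun _ _ => Matrix.one_apply⟩, ?_⟩
  have : Matrix.vecMulLinear (1 : Matrix (Fin n) (Fin n) F) = LinearMap.id :=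
    LinearMap.ext Matrix.vecMul_one
  rw [this, Submodule.map_id]

/-- Two codes are equivalent exactly when their column multiplicities differ by a projectivity. -/
lemma Represents.codeEquiv_iff [Fintype F] {C D : Submodule F (Fin n → F)}
    {P Q : Fin n → ℙ F (Fin k → F)}
    (hC : Represents C P) (hD : Represents D Q) :
    codeEquiv C D ↔ ∃ A : (Fin k → F) ≃ₗ[F] (Fin k → F),
      ∀ p, multiplicity Q (Projectivization.map A.toLinearMap A.injective p) =
        multiplicity P p := by
  obtain ⟨G, hGinj, rfl, hG⟩ := hC
  obtain ⟨H, hHinj, rfl, hH⟩ := hD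
  constructor
  · rintro ⟨M, ⟨σ, c, hc, hM⟩, hMap⟩
    let T := M.vecMulLinear ∘ₗ G.mulVecLin
    have hT : Function.Injective T := by
      refine Function.Injective.comp (g := M.vecMulLinear) (fun z w hzw => ?_) hGinj
      funext i
      have := congrFun hzw (σ i)
      simp only [Matrix.vecMulLinear_apply, vecMul_monomial hM] at this
      exact mul_right_cancel₀ (hc i) this
    have hTr : LinearMap.range H.mulVecLin = LinearMap.range T := by
      rw [hMap, LinearMap.range_comp]
    let B : (Fin k → F) ≃ₗ[F] (Fin k → F) :=
      (LinearEquiv.ofInjective _ hHinj).trans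
        ((LinearEquiv.ofEq _ _ hTr).trans (LinearEquiv.ofInjective T hT).symm)
    have hB : ∀ x, T (B x) = H *ᵥ x := fun x => by
      have := congrArg Subtype.val ((LinearEquiv.ofInjective T hT).apply_symm_apply
        (LinearEquiv.ofEq _ _ hTr (LinearEquiv.ofInjective _ hHinj x)))
      simp [B] at this ⊢
    obtain ⟨A, hA⟩ := exists_dotProduct_adjoint B
    have hrow : ∀ i, H (σ i) = c i • A (G i) := by
      intro i
      refine dotProduct_eq _ _ fun x => ?_
      have := congrFun (hB x) (σ i)
      simp only [T, LinearMap.comp_apply, Matrix.vecMulLinear_apply, vecMul_monomial hM] at this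
      rw [smul_dotProduct, hA, smul_eq_mul, mul_comm]
      exact this.symm
    have hQ : ∀ i, Q (σ i) = Projectivization.map A.toLinearMap A.injective (P i) := by
      intro i
      obtain ⟨a, ha, hGi⟩ := hG i
      obtain ⟨b, hb, hHi⟩ := hH (σ i)
      rw [← (Q (σ i)).mk_rep, ← (P i).mk_rep, Projectivization.map_mk,
        Projectivization.mk_eq_mk_iff']
      refine ⟨b⁻¹ * (c i * a), ?_⟩
      have := hrow i
      rw [hHi, hGi, map_smul, smul_smul] at this
      rw [mul_smul, LinearEquiv.coe_coe, ← this, inv_smul_smul₀ hb]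
    refine ⟨A, fun p => ?_⟩
    rw [multiplicity, multiplicity]
    refine (Finset.card_equiv σ fun i => ?_).symm
    simp [hQ, (Projectivization.map_injective A.toLinearMap A.injective).eq_iff]
  · rintro ⟨A, hA⟩
    have hfib : ∀ p, Nonempty ({i // Projectivization.map A.toLinearMap A.injective (P i) = p} ≃
        {i // Q i = p}) := by
      intro p
      have hsurj : Function.Surjective (Projectivization.map A.toLinearMap A.injective) :=
        Finite.surjective_of_injective
          (Projectivization.map_injective A.toLinearMap A.injective)
      obtain ⟨p, rfl⟩ := hsurj p
      refine ⟨Fintype.equivOfCardEq ?_⟩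
      rw [Fintype.card_subtype, Fintype.card_subtype]
      simp only [(Projectivization.map_injective A.toLinearMap A.injective).eq_iff]
      exact (hA p).symm
    let σ : Equiv.Perm (Fin n) := Equiv.ofFiberEquiv fun p => (hfib p).some
    have hQ : ∀ i, Q (σ i) = Projectivization.map A.toLinearMap A.injective (P i) :=
      Equiv.ofFiberEquiv_map _
    have hrow : ∀ i, ∃ c : F, c ≠ 0 ∧ H (σ i) = c • A (G i) := by
      intro i
      obtain ⟨a, ha, hGi⟩ := hG i
      obtain ⟨b, hb, hHi⟩ := hH (σ i)
      have h := hQ i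
      rw [← (Q (σ i)).mk_rep, ← (P i).mk_rep, Projectivization.map_mk,
        Projectivization.mk_eq_mk_iff] at h
      obtain ⟨u, hu⟩ := h
      refine ⟨b * u * a⁻¹, by simp [ha, hb], ?_⟩
      rw [hHi, hGi, ← hu, map_smul, smul_smul, mul_assoc _ _ a,
        inv_mul_cancel₀ ha, mul_one, mul_smul]
      rfl
    choose c hc hrow using hrow
    obtain ⟨B, hB⟩ := exists_dotProduct_adjoint A
    let M : Matrix (Fin n) (Fin n) F := Matrix.of fun i j => if σ i = j then c i else 0
    have hM : ∀ i j, M i j = if σ i = j then c i else 0 := fun _ _ => rfl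
    have hMB : ∀ x, (G *ᵥ B x) ᵥ* M = H *ᵥ x := by
      intro x
      funext j
      obtain ⟨i, rfl⟩ := σ.surjective j
      rw [vecMul_monomial hM]
      simp only [Matrix.mulVec, hrow, smul_dotProduct, smul_eq_mul]
      rw [mul_comm, dotProduct_comm (G i), hB, dotProduct_comm x]
    refine ⟨M, ⟨σ, c, hc, hM⟩, ?_⟩
    rw [← LinearMap.range_comp]
    ext y
    constructor
    · rintro ⟨x, rfl⟩
      exact ⟨B x, hMB x⟩
    · rintro ⟨x, rfl⟩
      refine ⟨B.symm x, ?_⟩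
      rw [Matrix.mulVecLin_apply, ← hMB, B.apply_symm_apply]
      rfl

end Equivalence

section Shift

variable {F : Type*} [Field F] [Fintype F] [DecidableEq F] {k n n' : ℕ}

/-- Adding `m` copies of every point of the projective space to the columns of a code gives, up to
equivalence, every code of the larger length and minimum weight. -/
lemma exists_shift (hF : ∀ c : F, c ≠ 0 → c * c = 1) (hk : 2 < (Fintype.card F - 1) * k)
    {m d d' : ℕ} (hn : n' = n + Fintype.card (ℙ F (Fin k → F)) * m)
    (hd : d' = d + m * Fintype.card F ^ (k - 1))
    (hm : Fintype.card F * d' = m + (Fintype.card F - 1) * n') :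
    ∃ f : {C : Submodule F (Fin n → F) //
          Module.finrank F C = k ∧ IsLCD C ∧ HasMinWeight C d ∧ DualDistGe C 2} →
        {C : Submodule F (Fin n' → F) //
          Module.finrank F C = k ∧ IsLCD C ∧ HasMinWeight C d' ∧ DualDistGe C 2},
      (∀ C₁ C₂, codeEquiv C₁.1 C₂.1 ↔ codeEquiv (f C₁).1 (f C₂).1) ∧
        ∀ D : {C : Submodule F (Fin n' → F) //
          Module.finrank F C = k ∧ IsLCD C ∧ HasMinWeight C d' ∧ DualDistGe C 2},
          ∃ C, codeEquiv (f C).1 D.1 := by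
  subst hd
  have hext : ∀ C : {C : Submodule F (Fin n → F) //
      Module.finrank F C = k ∧ IsLCD C ∧ HasMinWeight C d ∧ DualDistGe C 2},
      ∃ (P : Fin n → ℙ F (Fin k → F)) (Q : Fin n' → ℙ F (Fin k → F))
        (D : {C : Submodule F (Fin n' → F) // Module.finrank F C = k ∧ IsLCD C ∧
          HasMinWeight C (d + m * Fintype.card F ^ (k - 1)) ∧ DualDistGe C 2}),
        Represents C.1 P ∧ Represents D.1 Q ∧ ∀ p, multiplicity Q p = multiplicity P p + m := by
    rintro ⟨C, hC, hL, hw, hdd⟩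
    obtain ⟨P, hP⟩ := exists_represents hC hdd
    obtain ⟨Q, hQ⟩ := exists_multiplicity_eq (n := n') (fun p => multiplicity P p + m) (by
      rw [Finset.sum_add_distrib, sum_multiplicity, hn]
      simp)
    have hgood := (isLCDMult_add_const_iff hF hk _ m d).2
      ((hP.isLCD_and_hasMinWeight_iff hF d).1 ⟨hL, hw⟩)
    rw [← hQ] at hgood
    obtain ⟨D, hD⟩ := hgood.exists_represents
    have hD' := (hD.isLCD_and_hasMinWeight_iff hF _).2 hgood
    exact ⟨P, Q, ⟨D, hD.finrank_eq, hD'.1, hD'.2, hD.dualDistGe⟩, hP, hD, fun p => by rw [hQ]⟩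
  choose P Q f hP hQ hPQ using hext
  refine ⟨f, fun C₁ C₂ => ?_, ?_⟩
  · rw [(hP C₁).codeEquiv_iff (hP C₂), (hQ C₁).codeEquiv_iff (hQ C₂)]
    simp only [hPQ, Nat.add_right_cancel_iff]
  · rintro ⟨D, hD, hL, hw, hdd⟩
    obtain ⟨R, hR⟩ := exists_represents hD hdd
    have hgood := (hR.isLCD_and_hasMinWeight_iff hF _).1 ⟨hL, hw⟩
    have hle : ∀ p, m ≤ multiplicity R p := fun p => by
      have := card_mul_le_multiplicity hgood.2.2 p
      rw [sum_multiplicity, Fintype.card_fin, hm] at this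
      omega
    have hsub : ∀ p, multiplicity R p - m + m = multiplicity R p := fun p =>
      Nat.sub_add_cancel (hle p)
    obtain ⟨S, hS⟩ := exists_multiplicity_eq (n := n) (fun p => multiplicity R p - m) (by
      have h1 : ∑ p, (multiplicity R p - m + m) = n' := by
        simp only [hsub, sum_multiplicity, Fintype.card_fin]
      rw [Finset.sum_add_distrib, Finset.sum_const, smul_eq_mul, Finset.card_univ] at h1
      omega)
    have hgoodS : IsLCDMult (multiplicity S) d := by
      rw [← isLCDMult_add_const_iff hF hk _ m, hS]
      simpa only [hsub] using hgood
    obtain ⟨C, hC⟩ := hgoodS.exists_represents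
    have hC' := (hC.isLCD_and_hasMinWeight_iff hF _).2 hgoodS
    let C' : {C : Submodule F (Fin n → F) //
        Module.finrank F C = k ∧ IsLCD C ∧ HasMinWeight C d ∧ DualDistGe C 2} :=
      ⟨C, hC.finrank_eq, hC'.1, hC'.2, hC.dualDistGe⟩
    refine ⟨C', ?_⟩
    obtain ⟨A, hA⟩ := ((hP C').codeEquiv_iff hC).1 (codeEquiv_refl C)
    refine ((hQ C').codeEquiv_iff hR).2 ⟨A, fun p => ?_⟩
    rw [hPQ, ← hA, hS, hsub]

end Shift

end LCDCode

/-- For `n = [k]_q·s + t` and `d = q^{k-1}·s + α` with `s ≥ s' = (q·r − t)/[k]_q + 1`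
(encoded by `q·r = [k]_q·(s'−1) + t` via `s'' = s'−1`), there is a one-to-one
correspondence between equivalence classes of LCD `[q·r, k, (q−1)·r]` codes with dual
distance `≥ 2` and equivalence classes of LCD `[[k]_q·s + t, k, q^{k-1}·s + α]` codes
with dual distance `≥ 2`, where `r = q^{k-1}·t − [k]_q·α`. -/
theorem class_bijection_family {q k₀ k t r s'' : ℕ} {α : ℤ}
    (hq : (q = 2 ∧ k₀ = 3) ∨ (q = 3 ∧ k₀ = 2)) (hk : k₀ ≤ k)
    (ht : t < qrep q k)
    (hr : (r : ℤ) = (q : ℤ) ^ (k - 1) * t - (qrep q k : ℤ) * α)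
    (hs : q * r = qrep q k * s'' + t)
    (hqr : k ≤ q * r) :
    ∀ s : ℕ, s'' + 1 ≤ s → k ≤ qrep q k * s + t →
      ∀ w : ℕ, (w : ℤ) = (q : ℤ) ^ (k - 1) * s + α →
        ∃ f : {C : Submodule (ZMod q) (Fin (q * r) → ZMod q) //
                Module.finrank (ZMod q) C = k ∧ IsLCD C ∧ HasMinWeight C ((q - 1) * r) ∧
                DualDistGe C 2} →
              {C : Submodule (ZMod q) (Fin (qrep q k * s + t) → ZMod q) //
                Module.finrank (ZMod q) C = k ∧ IsLCD C ∧ HasMinWeight C w ∧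
                DualDistGe C 2},
          (∀ C₁ C₂, codeEquiv C₁.1 C₂.1 ↔ codeEquiv (f C₁).1 (f C₂).1) ∧
          (∀ D : {C : Submodule (ZMod q) (Fin (qrep q k * s + t) → ZMod q) //
                Module.finrank (ZMod q) C = k ∧ IsLCD C ∧ HasMinWeight C w ∧
                DualDistGe C 2},
        ∃ C, codeEquiv (f C).1 D.1) := by
  have hF : ∀ c : ZMod q, c ≠ 0 → c * c = 1 := by
    rcases hq with ⟨rfl, -⟩ | ⟨rfl, -⟩ <;> decide
  have hq' : Fact q.Prime := ⟨by rcases hq with ⟨rfl, -⟩ | ⟨rfl, -⟩ <;> norm_num⟩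
  have hdim : 2 < (Fintype.card (ZMod q) - 1) * k := by
    rw [ZMod.card]
    rcases hq with ⟨rfl, rfl⟩ | ⟨rfl, rfl⟩ <;> omega
  have hq1 : 1 < q := hq'.out.one_lt
  have hk0 : 0 < k := by omega
  intro s hss _ w hw
  obtain ⟨m, rfl⟩ : ∃ m, s = s'' + m := ⟨s - s'', by omega⟩
  have hgeom : ((q : ℤ) - 1) * qrep q k = q * q ^ (k - 1) - 1 := by
    rw [mul_pow_sub_one hk0.ne', qrep]
    push_cast
    rw [mul_comm, geom_sum_mul]
  have hrep : (qrep q k : ℤ) ≠ 0 := by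
    exact_mod_cast (Nat.zero_le _ |>.trans_lt ht).ne'
  have hs' : (q : ℤ) * r = qrep q k * s'' + t := by exact_mod_cast hs
  have hd : w = (q - 1) * r + m * q ^ (k - 1) := by
    zify [hq1.le]
    refine mul_left_cancel₀ hrep ?_
    rw [hw]
    push_cast
    linear_combination -(r : ℤ) * hgeom - (q : ℤ) ^ (k - 1) * hs' + hr
  have hm : q * w = m + (q - 1) * (qrep q k * (s'' + m) + t) := by
    zify [hq1.le]
    refine mul_left_cancel₀ hrep ?_
    rw [hw]
    push_cast
    linear_combination -(qrep q k * (s'' + m) + t : ℤ) * hgeom - hs' + q * hr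
  refine LCDCode.exists_shift (m := m) hF hdim ?_ ?_ ?_
  · rw [LCDCode.card_projectivization q (ZMod.card q), hs]
    ring
  · rw [ZMod.card, hd]
  · rw [ZMod.card, hm]
end

section
/- For every integer n ≥ 4, the largest minimum weight d₂(n,4) among all binary LCD [n,4] codes equals ⌊8n/15⌋ if n ≡ 5, 9, or 13 (mod 15); equals ⌊8n/15⌋ − 1 if n ≡ 1,2,3,4,6,7,8,10,11,12, or 14 (mod 15); and equals ⌊8n/15⌋ − 2 if n ≡ 0 (mod 15). -/
open Matrix Finset

/-- The claimed value of `d₂(n,4)`. -/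
def d2n4 (n : ℕ) : ℕ :=
  if n % 15 = 5 ∨ n % 15 = 9 ∨ n % 15 = 13 then 8 * n / 15
  else if n % 15 = 0 then 8 * n / 15 - 2
  else 8 * n / 15 - 1

/-- The rows of `M` generate an LCD code for which `M` has full rank. -/
def NondegGram {k n : ℕ} (M : Matrix (Fin k) (Fin n) (ZMod 2)) : Prop :=
  ∀ u : Fin k → ZMod 2, M *ᵥ (u ᵥ* M) = 0 → u = 0

theorem exists_nondegGram_of_isLCD {k n : ℕ} {C : Submodule (ZMod 2) (Fin n → ZMod 2)}
    (hC : Module.finrank (ZMod 2) C = k) (hL : IsLCD C) :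
    ∃ M : Matrix (Fin k) (Fin n) (ZMod 2), NondegGram M ∧ ∀ u, u ᵥ* M ∈ C := by
  let b := Module.finBasisOfFinrankEq (ZMod 2) C hC
  let M : Matrix (Fin k) (Fin n) (ZMod 2) := Matrix.of fun i => (b i : Fin n → ZMod 2)
  have hM (u : Fin k → ZMod 2) : u ᵥ* M = ((∑ i, u i • b i : C) : Fin n → ZMod 2) := by
    rw [vecMul_eq_sum]; simp only [Submodule.coe_sum, Submodule.coe_smul]; rfl
  refine ⟨M, fun u hu => ?_, fun u => hM u ▸ Subtype.prop _⟩
  have hdual : u ᵥ* M ∈ dualCode C := by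
    intro y hy
    have hy' : y = (b.repr ⟨y, hy⟩) ᵥ* M := by rw [hM, b.sum_repr]
    change (u ᵥ* M) ⬝ᵥ y = 0
    rw [dotProduct_comm, hy', ← dotProduct_mulVec, hu, dotProduct_zero]
  have h0 : u ᵥ* M = 0 := by
    have : u ᵥ* M ∈ C ⊓ dualCode C := ⟨hM u ▸ Subtype.prop _, hdual⟩
    rwa [hL, Submodule.mem_bot] at this
  rw [hM, Submodule.coe_eq_zero] at h0
  exact funext fun i => Fintype.linearIndependent_iff.1 b.linearIndependent u h0 i

theorem NondegGram.injective {k n : ℕ} {M : Matrix (Fin k) (Fin n) (ZMod 2)} (h : NondegGram M)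
    {u : Fin k → ZMod 2} (hu : u ᵥ* M = 0) : u = 0 :=
  h u (by rw [hu, mulVec_zero])

theorem NondegGram.isLCD {k n : ℕ} {M : Matrix (Fin k) (Fin n) (ZMod 2)} (h : NondegGram M) :
    IsLCD (LinearMap.range M.vecMulLinear) := by
  refine (Submodule.eq_bot_iff _).2 ?_
  rintro _ ⟨⟨u, rfl⟩, hd⟩
  have hu : u = 0 := h u <| by
    ext i
    have := hd (M i) ⟨Pi.single i 1, by simp [Matrix.row]⟩
    rw [mulVec, dotProduct_comm]
    exact this
  simp [hu]

theorem NondegGram.finrank {k n : ℕ} {M : Matrix (Fin k) (Fin n) (ZMod 2)} (h : NondegGram M) :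
    Module.finrank (ZMod 2) (LinearMap.range M.vecMulLinear) = k := by
  rw [LinearMap.finrank_range_of_inj]
  · simp
  · exact (injective_iff_map_eq_zero _).2 fun u hu => h.injective hu

theorem wt_add_two_mul {n : ℕ} (x y : Fin n → ZMod 2) :
    wt (x + y) + 2 * #{i | x i * y i ≠ 0} = wt x + wt y := by
  have key : ∀ a b : ZMod 2, (if a + b ≠ 0 then 1 else 0) + 2 * (if a * b ≠ 0 then 1 else 0) =
      (if a ≠ 0 then 1 else 0) + (if b ≠ 0 then 1 else 0) := by
    decide
  simp only [wt, card_filter, mul_sum, ← sum_add_distrib, Pi.add_apply, key]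

theorem natCast_card_ne_zero {n : ℕ} (x : Fin n → ZMod 2) :
    ((#{i | x i ≠ 0} : ℕ) : ZMod 2) = ∑ i, x i := by
  have key : ∀ a : ZMod 2, (if a ≠ 0 then 1 else 0) = a := by decide
  simp only [card_filter, Nat.cast_sum, Nat.cast_ite, Nat.cast_one, Nat.cast_zero, key]

/-- The imaginary unit of the Gaussian integers. -/
def gaussI : GaussianInt := ⟨0, 1⟩

theorem gaussI_sq : gaussI ^ 2 = -1 := by decide

theorem gaussI_mul_star : gaussI * star gaussI = 1 := by decide

theorem gaussI_pow_mul_star (m : ℕ) : gaussI ^ m * star (gaussI ^ m) = 1 := by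
  rw [star_pow, ← mul_pow, gaussI_mul_star, one_pow]

theorem mod_four_eq_gaussI_pow (m : ℕ) :
    ((m % 4 : ℕ) : ℤ) = 1 + (m % 2 : ℕ) - (gaussI ^ m).re - (gaussI ^ m).im := by
  have hm : gaussI ^ m = gaussI ^ (m % 4) := by
    conv_lhs => rw [← Nat.div_add_mod m 4, pow_add, pow_mul]
    rw [show gaussI ^ 4 = 1 by decide, one_pow, one_mul]
  rw [hm, ← Nat.mod_mod_of_dvd m (by norm_num : 2 ∣ 4)]
  have hlt : m % 4 < 4 := Nat.mod_lt _ (by norm_num)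
  generalize m % 4 = r at hlt
  decide +revert

theorem gaussI_pow_wt_add {n : ℕ} (x y : Fin n → ZMod 2) :
    gaussI ^ wt (x + y) = gaussI ^ wt x * gaussI ^ wt y * (-1) ^ (x ⬝ᵥ y).val := by
  have hpar : (-1 : GaussianInt) ^ (x ⬝ᵥ y).val = (-1) ^ #{i | x i * y i ≠ 0} := by
    rw [dotProduct, ← natCast_card_ne_zero fun i => x i * y i, ZMod.val_natCast,
      ← neg_one_pow_eq_pow_mod_two]
  rw [hpar, ← pow_add, ← wt_add_two_mul, pow_add, pow_mul, gaussI_sq, mul_assoc, ← mul_pow]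
  simp

theorem sum_neg_one_pow_dotProduct {k : ℕ} {y : Fin k → ZMod 2} (hy : y ≠ 0) :
    ∑ u : Fin k → ZMod 2, (-1 : GaussianInt) ^ (u ⬝ᵥ y).val = 0 := by
  obtain ⟨i, hi⟩ := Function.ne_iff.1 hy
  have hi1 : y i = 1 := Fin.eq_one_of_ne_zero _ hi
  have key : ∀ a : ZMod 2, (-1 : GaussianInt) ^ (a + 1).val = -(-1) ^ a.val := by decide
  have hneg : ∑ u : Fin k → ZMod 2, (-1 : GaussianInt) ^ (u ⬝ᵥ y).val =
      -∑ u : Fin k → ZMod 2, (-1 : GaussianInt) ^ (u ⬝ᵥ y).val := by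
    rw [← sum_neg_distrib]
    refine (Fintype.sum_equiv (Equiv.addRight (Pi.single i (1 : ZMod 2))) _ _ fun u => ?_).symm
    simp [add_dotProduct, hi1, key]
  exact self_eq_neg.1 hneg

/-- The Gauss sum of the weights of an LCD code has norm the size of the code. -/
theorem NondegGram.gaussSum_mul_star {k n : ℕ} {M : Matrix (Fin k) (Fin n) (ZMod 2)}
    (h : NondegGram M) :
    (∑ u : Fin k → ZMod 2, gaussI ^ wt (u ᵥ* M)) * star (∑ u, gaussI ^ wt (u ᵥ* M)) = 2 ^ k := by
  have hterm (u v : Fin k → ZMod 2) :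
      gaussI ^ wt ((v + u) ᵥ* M) * star (gaussI ^ wt (u ᵥ* M)) =
        gaussI ^ wt (v ᵥ* M) * (-1) ^ (u ⬝ᵥ (M *ᵥ (v ᵥ* M))).val := by
    rw [add_vecMul, gaussI_pow_wt_add, dotProduct_comm (v ᵥ* M), ← dotProduct_mulVec]
    linear_combination gaussI ^ wt (v ᵥ* M) * (-1) ^ (u ⬝ᵥ (M *ᵥ (v ᵥ* M))).val *
      gaussI_pow_mul_star (wt (u ᵥ* M))
  calc _ = ∑ u, ∑ v, gaussI ^ wt ((v + u) ᵥ* M) * star (gaussI ^ wt (u ᵥ* M)) := by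
        rw [star_sum, sum_mul_sum, sum_comm]
        exact sum_congr rfl fun u _ => (Fintype.sum_equiv (Equiv.addRight u) _
          (fun v => gaussI ^ wt (v ᵥ* M) * star (gaussI ^ wt (u ᵥ* M))) fun _ => rfl).symm
    _ = ∑ v, gaussI ^ wt (v ᵥ* M) *
          ∑ u : Fin k → ZMod 2, (-1) ^ (u ⬝ᵥ (M *ᵥ (v ᵥ* M))).val := by
        simp_rw [hterm]
        rw [sum_comm]
        simp_rw [mul_sum]
    _ = 2 ^ k := by
        rw [sum_eq_single 0]
        · simp [wt]
        · intro v _ hv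
          rw [sum_neg_one_pow_dotProduct (mt (h v) hv), mul_zero]
        · simp

theorem NondegGram.le_sum_residue {n : ℕ} {M : Matrix (Fin 4) (Fin n) (ZMod 2)}
    (h : NondegGram M) (c : ℕ) :
    11 + ∑ u : Fin 4 → ZMod 2, (wt (u ᵥ* M) + c) % 2 ≤
      ∑ u : Fin 4 → ZMod 2, (wt (u ᵥ* M) + c) % 4 := by
  obtain ⟨T, hT⟩ : ∃ T, T = ∑ u : Fin 4 → ZMod 2, gaussI ^ (wt (u ᵥ* M) + c) := ⟨_, rfl⟩
  have hnorm : T * star T = 2 ^ 4 := by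
    simp_rw [hT, pow_add, ← sum_mul]
    rw [star_mul', mul_mul_mul_comm, h.gaussSum_mul_star, gaussI_pow_mul_star, mul_one]
  have hre : T.re * T.re + T.im * T.im = 16 := by
    have := congrArg Zsqrtd.re hnorm
    rw [show (2 ^ 4 : GaussianInt) = ⟨16, 0⟩ by decide] at this
    simpa using this
  have hsum : ((∑ u : Fin 4 → ZMod 2, (wt (u ᵥ* M) + c) % 4 : ℕ) : ℤ) =
      16 + (∑ u : Fin 4 → ZMod 2, (wt (u ᵥ* M) + c) % 2 : ℕ) - T.re - T.im := by
    have hadd (f : (Fin 4 → ZMod 2) → GaussianInt) :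
        (∑ u, f u).re = ∑ u, (f u).re ∧ (∑ u, f u).im = ∑ u, (f u).im :=
      ⟨map_sum (AddMonoidHom.mk' (Zsqrtd.re (d := -1)) Zsqrtd.re_add) f univ,
        map_sum (AddMonoidHom.mk' (Zsqrtd.im (d := -1)) Zsqrtd.im_add) f univ⟩
    rw [hT, (hadd _).1, (hadd _).2, Nat.cast_sum, Nat.cast_sum]
    simp_rw [mod_four_eq_gaussI_pow, sum_sub_distrib, sum_add_distrib]
    simp
  have hle : T.re + T.im ≤ 5 := by nlinarith [sq_nonneg (T.re - T.im)]
  lia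

theorem card_dotProduct_ne_zero_le :
    ∀ x : Fin 4 → ZMod 2, #{u : Fin 4 → ZMod 2 | u ⬝ᵥ x ≠ 0} ≤ 8 := by
  decide +kernel

theorem sum_wt_vecMul_le {n : ℕ} (M : Matrix (Fin 4) (Fin n) (ZMod 2)) :
    ∑ u : Fin 4 → ZMod 2, wt (u ᵥ* M) ≤ 8 * n := by
  simp_rw [wt, card_filter]
  rw [sum_comm]
  calc _ ≤ ∑ _l : Fin n, 8 := sum_le_sum fun l _ => by
        rw [← card_filter]; exact card_dotProduct_ne_zero_le fun i => M i l
    _ = 8 * n := by simp [mul_comm]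

theorem sum_wt_vecMul_mod_two_le {n : ℕ} (M : Matrix (Fin 4) (Fin n) (ZMod 2)) :
    ∑ u : Fin 4 → ZMod 2, wt (u ᵥ* M) % 2 ≤ 8 := by
  have key : ∀ a : ZMod 2, a.val = if a ≠ 0 then 1 else 0 := by decide
  have hmod (u : Fin 4 → ZMod 2) :
      wt (u ᵥ* M) % 2 = if u ⬝ᵥ (M *ᵥ 1) ≠ 0 then 1 else 0 := by
    rw [dotProduct_mulVec, dotProduct_one, ← natCast_card_ne_zero, ← key, ZMod.val_natCast, wt]
  simp_rw [hmod, ← card_filter]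
  exact card_dotProduct_ne_zero_le _

theorem NondegGram.le_d2n4 {n d : ℕ} {M : Matrix (Fin 4) (Fin n) (ZMod 2)} (h : NondegGram M)
    (hd : ∀ u, u ≠ 0 → d ≤ wt (u ᵥ* M)) : d ≤ d2n4 n := by
  have hres : ∑ u : Fin 4 → ZMod 2, (wt (u ᵥ* M) + 3 * d) % 4 + 15 * d ≤ 8 * n + 3 * d % 4 := by
    have hpt : ∀ u ∈ univ.erase (0 : Fin 4 → ZMod 2),
        (wt (u ᵥ* M) + 3 * d) % 4 + d ≤ wt (u ᵥ* M) := fun u hu => by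
      have := hd u (ne_of_mem_erase hu)
      omega
    have hle := sum_le_sum hpt
    have hcard : #(univ.erase (0 : Fin 4 → ZMod 2)) = 15 := by decide
    have htot := sum_wt_vecMul_le M
    have h0 : wt (0 ᵥ* M) = 0 := by simp [wt]
    rw [sum_add_distrib, sum_const, hcard, smul_eq_mul] at hle
    rw [← add_sum_erase _ _ (mem_univ 0), h0] at htot ⊢
    omega
  have hodd : 8 * (d % 2) ≤ ∑ u : Fin 4 → ZMod 2, (wt (u ᵥ* M) + 3 * d) % 2 := by
    rcases Nat.mod_two_eq_zero_or_one d with hd2 | hd2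
    · simp [hd2]
    · have hcompl : ∑ u : Fin 4 → ZMod 2, ((wt (u ᵥ* M) + 3 * d) % 2 + wt (u ᵥ* M) % 2) = 16 := by
        rw [sum_congr rfl fun u _ => show _ = 1 by omega]
        simp
      have := sum_wt_vecMul_mod_two_le M
      rw [sum_add_distrib] at hcompl
      omega
  have hlow := h.le_sum_residue (3 * d)
  have hbound : 11 + 8 * (d % 2) + 15 * d ≤ 8 * n + 3 * d % 4 := by omega
  clear hres hodd hlow hd
  have hn := Nat.div_add_mod n 15
  have hr : n % 15 < 15 := Nat.mod_lt _ (by norm_num)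
  have hd4 := Nat.div_add_mod d 4
  have hd4' : d % 4 < 4 := Nat.mod_lt _ (by norm_num)
  unfold d2n4
  generalize n % 15 = r at *
  generalize d % 4 = c at *
  subst_vars
  interval_cases c <;> interval_cases r <;> simp <;> omega

/-- `M` is a generator matrix with nondegenerate Gram matrix, of a code of minimum weight `d`. -/
def GeneratesLCD {k n : ℕ} (M : Matrix (Fin k) (Fin n) (ZMod 2)) (d : ℕ) : Prop :=
  NondegGram M ∧ (∀ u, u ≠ 0 → d ≤ wt (u ᵥ* M)) ∧ ∃ u, u ≠ 0 ∧ wt (u ᵥ* M) = d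

theorem GeneratesLCD.exists_code {k n d : ℕ} {M : Matrix (Fin k) (Fin n) (ZMod 2)}
    (h : GeneratesLCD M d) : ∃ C : Submodule (ZMod 2) (Fin n → ZMod 2),
      Module.finrank (ZMod 2) C = k ∧ IsLCD C ∧ HasMinWeight C d := by
  obtain ⟨hM, hmin, u, hu, hud⟩ := h
  refine ⟨_, hM.finrank, hM.isLCD, ⟨u ᵥ* M, ⟨u, rfl⟩, fun h0 => hu (hM.injective h0), hud⟩, ?_⟩
  rintro _ ⟨v, rfl⟩ hv
  exact hmin v fun h0 => hv (by simp [h0])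

/-- The matrix whose columns are the binary expansions of the entries of a list. -/
def bitMatrix (k n : ℕ) (l : List ℕ) : Matrix (Fin k) (Fin n) (ZMod 2) :=
  Matrix.of fun i j => if (l.getD j 0).testBit i then 1 else 0

theorem vecMul_append {k m n : ℕ} (A : Matrix (Fin k) (Fin m) (ZMod 2))
    (B : Matrix (Fin k) (Fin n) (ZMod 2)) (u : Fin k → ZMod 2) :
    u ᵥ* (Matrix.of fun i => Fin.append (A i) (B i)) = Fin.append (u ᵥ* A) (u ᵥ* B) := by
  ext j
  refine Fin.addCases (fun j => ?_) (fun j => ?_) j <;> simp [vecMul, dotProduct]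

theorem mulVec_append {k m n : ℕ} (A : Matrix (Fin k) (Fin m) (ZMod 2))
    (B : Matrix (Fin k) (Fin n) (ZMod 2)) (x : Fin m → ZMod 2) (y : Fin n → ZMod 2) :
    (Matrix.of fun i => Fin.append (A i) (B i)) *ᵥ Fin.append x y = A *ᵥ x + B *ᵥ y := by
  ext i
  simp [mulVec, dotProduct, Fin.sum_univ_add]

theorem wt_append {m n : ℕ} (x : Fin m → ZMod 2) (y : Fin n → ZMod 2) :
    wt (Fin.append x y) = wt x + wt y := by
  simp only [wt, card_filter, Fin.sum_univ_add, Fin.append_left, Fin.append_right]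

theorem GeneratesLCD.append_simplex {n d : ℕ} {M : Matrix (Fin 4) (Fin n) (ZMod 2)}
    (h : GeneratesLCD M d) :
    GeneratesLCD (Matrix.of fun i => Fin.append (M i) (bitMatrix 4 15 (List.range' 1 15) i))
      (d + 8) := by
  have hwt : ∀ u, u ≠ 0 → wt (u ᵥ* bitMatrix 4 15 (List.range' 1 15)) = 8 := by
    decide +kernel
  have horth : ∀ u, bitMatrix 4 15 (List.range' 1 15) *ᵥ
      (u ᵥ* bitMatrix 4 15 (List.range' 1 15)) = 0 := by
    decide +kernel
  generalize bitMatrix 4 15 (List.range' 1 15) = S at hwt horth ⊢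
  obtain ⟨hM, hmin, u, hu, hud⟩ := h
  refine ⟨fun v hv => hM v ?_, fun v hv => ?_, u, hu, ?_⟩
  · rwa [vecMul_append, mulVec_append, horth, add_zero] at hv
  · rw [vecMul_append, wt_append, hwt v hv]
    exact Nat.add_le_add_right (hmin v hv) 8
  · rw [vecMul_append, wt_append, hwt u hu, hud]

instance {k n d : ℕ} (M : Matrix (Fin k) (Fin n) (ZMod 2)) : Decidable (GeneratesLCD M d) := by
  unfold GeneratesLCD NondegGram; infer_instance

theorem exists_generatesLCD_base : ∀ n < 19, 4 ≤ n → ∃ l ∈ [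
    [2, 3, 4, 12],
    [4, 5, 7, 9, 15],
    [4, 4, 5, 6, 11, 12],
    [1, 2, 6, 7, 8, 10, 12],
    [1, 2, 3, 6, 7, 10, 12, 14],
    [1, 2, 3, 4, 5, 9, 10, 12, 14],
    [3, 5, 6, 7, 10, 11, 11, 13, 15, 15],
    [4, 8, 9, 11, 11, 12, 13, 13, 14, 14, 15],
    [1, 2, 3, 4, 5, 5, 8, 10, 11, 12, 13, 15],
    [1, 3, 5, 6, 7, 8, 9, 10, 12, 12, 13, 14, 14],
    [1, 2, 3, 5, 5, 6, 6, 7, 8, 9, 10, 12, 13, 14],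
    [1, 3, 4, 5, 5, 6, 6, 7, 8, 9, 11, 12, 13, 14, 15],
    [1, 4, 4, 5, 6, 6, 7, 8, 8, 9, 10, 11, 12, 13, 14, 15],
    [1, 2, 3, 3, 4, 5, 6, 6, 7, 8, 8, 9, 9, 11, 12, 13, 15],
    [1, 2, 3, 4, 4, 5, 5, 7, 8, 9, 9, 10, 11, 12, 13, 14, 14, 15]],
    l.length = n ∧ GeneratesLCD (bitMatrix 4 n l) (d2n4 n) := by
  decide +kernel

theorem exists_generatesLCD (n : ℕ) (hn : 4 ≤ n) :
    ∃ M : Matrix (Fin 4) (Fin n) (ZMod 2), GeneratesLCD M (d2n4 n) := by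
  induction n using Nat.strong_induction_on with
  | _ n ih =>
    by_cases hlt : n < 19
    · obtain ⟨l, -, -, hl⟩ := exists_generatesLCD_base n hlt hn
      exact ⟨_, hl⟩
    · obtain ⟨m, rfl⟩ : ∃ m, n = m + 15 := ⟨n - 15, by omega⟩
      obtain ⟨M, hM⟩ := ih m (by omega) (by omega)
      have hd : d2n4 (m + 15) = d2n4 m + 8 := by
        unfold d2n4
        split_ifs <;> omega
      exact hd ▸ ⟨_, hM.append_simplex⟩

/-- Determination of the largest minimum weight `d₂(n,4)` among binary LCD `[n,4]`
codes, for every `n ≥ 4`. -/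
theorem d2_n_4 (n : ℕ) (hn : 4 ≤ n) :
    (∃ C : Submodule (ZMod 2) (Fin n → ZMod 2),
      Module.finrank (ZMod 2) C = 4 ∧ IsLCD C ∧ HasMinWeight C (d2n4 n)) ∧
    ∀ (C : Submodule (ZMod 2) (Fin n → ZMod 2)) (d : ℕ),
      Module.finrank (ZMod 2) C = 4 → IsLCD C → HasMinWeight C d → d ≤ d2n4 n := by
  obtain ⟨M, hM⟩ := exists_generatesLCD n hn
  refine ⟨hM.exists_code, fun C d hC hL hd => ?_⟩
  obtain ⟨M, hM, hMC⟩ := exists_nondegGram_of_isLCD hC hL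
  exact hM.le_d2n4 fun u hu => hd.2 _ (hMC u) fun h0 => hu (hM.injective h0)
end
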